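/- Let n = 2r be an integer divisible by 4 and let F be a field with char F = 0 or char F > r. Then the coordinate ring F[V] is an integral domain. -/

import Mathlib

open scoped Matrix

noncomputable section

namespace PR

/-- The polynomial ring `R[Y_{ij} : 1 ≤ i, j ≤ n]`, `n = 2r`. -/
abbrev PolyRing (r : ℕ) (R : Type*) [CommRing R] :=
  MvPolynomial (Fin (2 * r) × Fin (2 * r)) R

/-- The standard symplectic form matrix `J` (`n = 2r`). -/
def Jmat (r : ℕ) (R : Type*) [CommRing R] : Matrix (Fin (2 * r)) (Fin (2 * r)) R :=
  Matrix.of fun i j =>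
    if (j : ℕ) = (i : ℕ) + r then 1 else if (i : ℕ) = (j : ℕ) + r then -1 else 0

/-- The generic `n × n` matrix of indeterminates. -/
def Ygen (r : ℕ) (R : Type*) [CommRing R] :
    Matrix (Fin (2 * r)) (Fin (2 * r)) (MvPolynomial (Fin (2 * r) × Fin (2 * r)) R) :=
  Matrix.of fun i j => MvPolynomial.X (i, j)

/-- The defining ideal of the scheme `V`. -/
def VIdeal (r : ℕ) (R : Type*) [CommRing R] :
    Ideal (MvPolynomial (Fin (2 * r) × Fin (2 * r)) R) :=
  Ideal.span
    ({p | ∃ i j, p = (Ygen r R + (Ygen r R)ᵀ) i j} ∪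
     {p | ∃ i, p = Ygen r R i i} ∪
     {p | ∃ i j, p = ((Ygen r R)ᵀ * Jmat r (PolyRing r R) * Ygen r R) i j} ∪
     {p | ∃ k, p = (Matrix.charpoly (-(Jmat r (PolyRing r R) * Ygen r R)) - Polynomial.X ^ (2 * r)).coeff k})

/-- The coordinate ring `R[V]`. -/
abbrev FV (r : ℕ) (R : Type*) [CommRing R] :=
  MvPolynomial (Fin (2 * r) × Fin (2 * r)) R ⧸ VIdeal r R

/-- The pfaffian of an `m × m` matrix (nonzero only for even `m`), defined as a signed sum over
permutations `σ` with `σ(2i-1) < σ(2i)` for each pair and `σ(1) < σ(3) < ⋯` (here 0-indexed). -/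
def pf {m : ℕ} {R : Type*} [CommRing R] (A : Matrix (Fin m) (Fin m) R) : R :=
  ∑ σ ∈ Finset.univ.filter (fun σ : Equiv.Perm (Fin m) =>
      (∀ i : Fin (m / 2),
        σ ⟨2 * i.val, by have := i.isLt; omega⟩ < σ ⟨2 * i.val + 1, by have := i.isLt; omega⟩) ∧
      ∀ i j : Fin (m / 2), i < j →
        σ ⟨2 * i.val, by have := i.isLt; omega⟩ < σ ⟨2 * j.val, by have := j.isLt; omega⟩),
    (Equiv.Perm.sign σ : ℤ) •
      ∏ i : Fin (m / 2),
        A (σ ⟨2 * i.val, by have := i.isLt; omega⟩) (σ ⟨2 * i.val + 1, by have := i.isLt; omega⟩)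

/-- `[i₁, …, i₂ₗ]`: the pfaffian of the submatrix of `Y` given by a list of indices. -/
def listPf {n : ℕ} {R : Type*} [CommRing R] (Y : Matrix (Fin n) (Fin n) R)
    (L : List (Fin n)) : R :=
  pf (Matrix.of fun a b : Fin L.length => Y (L.get a) (L.get b))

/-- The product of pfaffians associated to a tableau (rows as lists of entries),
as a polynomial. -/
def tabPoly (r : ℕ) (R : Type*) [CommRing R] (T : List (List (Fin (2 * r)))) :
    MvPolynomial (Fin (2 * r) × Fin (2 * r)) R :=
  (T.map (listPf (Ygen r R))).prod

/-- `[T]`, the class of the product of pfaffians of the rows of `T` in `R[V]`. -/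
def tabElem (r : ℕ) (R : Type*) [CommRing R] (T : List (List (Fin (2 * r)))) : FV r R :=
  Ideal.Quotient.mk (VIdeal r R) (tabPoly r R T)

/-- Position of an index in the order `1̄ ≺ 1 ≺ 2̄ ≺ 2 ≺ ⋯ ≺ r̄ ≺ r`, where `ī := r + i`
(0-indexed: `ī` is `r + i - 1` and `i` is `i - 1`). -/
def ordIdx (r : ℕ) (x : Fin (2 * r)) : ℕ :=
  if x.val < r then 2 * x.val + 1 else 2 * (x.val - r)

/-- A list of rows represents a tableau of shape a partition: row lengths weakly decreasing
and positive. -/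
def IsShape {α : Type*} (T : List (List α)) : Prop :=
  (T.map List.length).Chain' (fun a b => b ≤ a) ∧ ∀ row ∈ T, row ≠ []

/-- An even-tableau: every row has even length. -/
def IsEvenTab {α : Type*} (T : List (List α)) : Prop :=
  ∀ row ∈ T, Even row.length

/-- Standard: entries strictly increase along each row and weakly increase down each column,
with respect to the order `≺`. -/
def IsStandard (r : ℕ) (T : List (List (Fin (2 * r)))) : Prop :=
  (∀ row ∈ T, row.Chain' (fun a b => ordIdx r a < ordIdx r b)) ∧
  ∀ (i t : ℕ) (hi : i + 1 < T.length) (ht' : t < (T[i]'(Nat.lt_of_succ_lt hi)).length)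
    (ht : t < (T[i + 1]'hi).length),
    ordIdx r ((T[i]'(Nat.lt_of_succ_lt hi))[t]'ht') ≤ ordIdx r ((T[i + 1]'hi)[t]'ht)

/-- The symplectic condition: the entries `p` and `p̄` (0-indexed: values `p` and `r + p`
for `p < r`) occur only in the first `p + 1` columns (0-indexed: columns `t ≤ p`). -/
def IsSymplectic (r : ℕ) (T : List (List (Fin (2 * r)))) : Prop :=
  ∀ (i t : ℕ) (hi : i < T.length) (ht : t < (T[i]'hi).length) (p : ℕ), p < r →
    (((T[i]'hi)[t]'ht).val = p ∨ ((T[i]'hi)[t]'ht).val = r + p) → t ≤ p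

/-- A symplectic standard even-tableau. -/
def IsSSET (r : ℕ) (T : List (List (Fin (2 * r)))) : Prop :=
  IsShape T ∧ IsEvenTab T ∧ IsStandard r T ∧ IsSymplectic r T

/-- A canonical tableau: in column `j` only `j̄` appears (0-indexed: column `t` contains
only the value `r + t`). -/
def IsCanonical (r : ℕ) (T : List (List (Fin (2 * r)))) : Prop :=
  ∀ (i t : ℕ) (hi : i < T.length) (ht : t < (T[i]'hi).length), ((T[i]'hi)[t]'ht).val = r + t

/-- The set `V(C)` of matrices. -/
def MemV (r : ℕ) {C : Type*} [CommRing C] (Y : Matrix (Fin (2 * r)) (Fin (2 * r)) C) : Prop :=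
  Y = -Yᵀ ∧ (∀ i, Y i i = 0) ∧ Yᵀ * Jmat r C * Y = 0 ∧
    Matrix.charpoly (-(Jmat r C * Y)) = Polynomial.X ^ (2 * r)

/-- The embedding `i ↦ i` of `{1, …, r}` into `{1, …, n}`. -/
def emb (r : ℕ) (i : Fin r) : Fin (2 * r) := ⟨i.val, by have := i.isLt; omega⟩

/-- The embedding `i ↦ ī = r + i` of `{1, …, r}` into `{1, …, n}`. -/
def embBar (r : ℕ) (i : Fin r) : Fin (2 * r) := ⟨r + i.val, by have := i.isLt; omega⟩

/-- The index list of `[P, Q̄]`: with `Γ₀ = P ∩ Q = {γ₁ < ⋯ < γ_λ}`, the list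
`γ₁, γ̄₁, …, γ_λ, γ̄_λ` followed by `P ∖ Γ₀` in increasing order and then the bars of
`Q ∖ Γ₀` in increasing order. -/
def pqList (r : ℕ) (P Q : Finset (Fin r)) : List (Fin (2 * r)) :=
  ((P ∩ Q).sort (· ≤ ·)).flatMap (fun γ => [emb r γ, embBar r γ]) ++
    ((P \ Q).sort (· ≤ ·)).map (emb r) ++ ((Q \ P).sort (· ≤ ·)).map (embBar r)

/-- The pfaffian `[P, Q̄]` of the matrix `Y`. -/
def pfPQ (r : ℕ) {C : Type*} [CommRing C] (Y : Matrix (Fin (2 * r)) (Fin (2 * r)) C)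
    (P Q : Finset (Fin r)) : C :=
  listPf Y (pqList r P Q)

/-- The defining ideal of the scheme `W`. -/
def WIdeal (r : ℕ) (R : Type*) [CommRing R] : Ideal (PolyRing r R) :=
  Ideal.span
    ({p | ∃ i j, p = (Jmat r (PolyRing r R) * (Ygen r R)ᵀ * Jmat r (PolyRing r R)
            + Ygen r R) i j} ∪
     {p | ∃ i j, p = (Ygen r R * Ygen r R) i j} ∪
     {p | ∃ k, p = (Matrix.charpoly (Ygen r R) - Polynomial.X ^ (2 * r)).coeff k})

/-- The coordinate ring `R[W]`. -/
abbrev FW (r : ℕ) (R : Type*) [CommRing R] := PolyRing r R ⧸ WIdeal r R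


section Pfaffian

variable {R S M X X' : Type*} [CommRing R] [CommRing S] [AddCommGroup M] [Module R M]

/-- The Pfaffian of the word `L` with respect to the pairing `y`, by expansion along the first
letter. -/
def pfL (y : X → X → R) : List X → R
  | [] => 1
  | a :: l => ∑ i : Fin l.length, (-1) ^ (i : ℕ) * y a (l.get i) * pfL y (l.eraseIdx i)
termination_by l => l.length
decreasing_by
  have := i.2
  rw [List.length_eraseIdx_of_lt this, List.length_cons]
  lia

@[simp] lemma pfL_nil (y : X → X → R) : pfL y [] = 1 := by rw [pfL]

lemma pfL_cons (y : X → X → R) (a : X) (l : List X) : pfL y (a :: l) =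
    ∑ i : Fin l.length, (-1) ^ (i : ℕ) * y a (l.get i) * pfL y (l.eraseIdx i) := by rw [pfL]

lemma map_pfL (f : R →+* S) (y : X → X → R) (L : List X) :
    f (pfL y L) = pfL (fun a b => f (y a b)) L := by
  induction hn : L.length using Nat.strong_induction_on generalizing L with
  | _ n ih =>
    cases L with
    | nil => simp
    | cons a l =>
      simp only [pfL_cons, map_sum, map_mul, map_pow, map_neg, map_one]
      refine Finset.sum_congr rfl fun i _ => ?_
      rw [ih _ _ (l.eraseIdx i) rfl]
      rw [List.length_eraseIdx_of_lt i.2, ← hn, List.length_cons]; lia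

lemma pfL_map (y : X' → X' → R) (f : X → X') (L : List X) :
    pfL y (L.map f) = pfL (fun a b => y (f a) (f b)) L := by
  induction hn : L.length using Nat.strong_induction_on generalizing L with
  | _ n ih =>
    cases L with
    | nil => simp
    | cons a l =>
      rw [List.map_cons, pfL_cons, pfL_cons]
      refine Fintype.sum_equiv (finCongr (by simp)) _ _ fun i => ?_
      have hi : (i : ℕ) < l.length := by simpa using i.2
      rw [List.eraseIdx_map, ih _ _ _ rfl]
      · simp
      · simp [List.length_eraseIdx_of_lt hi] at hn ⊢; lia

lemma pfL_congr {y y' : X → X → R} {L : List X} (h : ∀ a ∈ L, ∀ b ∈ L, y a b = y' a b) :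
    pfL y L = pfL y' L := by
  induction hn : L.length using Nat.strong_induction_on generalizing L with
  | _ n ih =>
    cases L with
    | nil => simp
    | cons a l =>
      rw [pfL_cons, pfL_cons]
      refine Finset.sum_congr rfl fun i _ => ?_
      rw [h a (by simp) _ (by simp), ih _ _ _ rfl]
      · rw [List.length_eraseIdx_of_lt i.2, ← hn, List.length_cons]; lia
      · intro b hb c hc
        exact h _ (List.mem_cons_of_mem _ (List.mem_of_mem_eraseIdx hb)) _
          (List.mem_cons_of_mem _ (List.mem_of_mem_eraseIdx hc))

open ExteriorAlgebra CliffordAlgebra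

/-- The product of the vectors `v x`, for `x` in the word `L`, in the exterior algebra. -/
def wedge (v : X → M) (L : List X) : ExteriorAlgebra R M :=
  (L.map fun x => ExteriorAlgebra.ι R (v x)).prod

@[simp] lemma wedge_nil (v : X → M) : wedge (R := R) v [] = 1 := by simp [wedge]

lemma wedge_cons (v : X → M) (a : X) (L : List X) :
    wedge (R := R) v (a :: L) = ExteriorAlgebra.ι R (v a) * wedge v L := by simp [wedge]

lemma wedge_append (v : X → M) (L L' : List X) :
    wedge (R := R) v (L ++ L') = wedge v L * wedge v L' := by simp [wedge]

/-- The functional on the exterior algebra whose value on a product of vectors is the Pfaffian of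
their Gram matrix with respect to `B`. -/
def pfW (B : LinearMap.BilinForm R M) (hB : B.IsAlt) : ExteriorAlgebra R M →ₗ[R] R :=
  (ExteriorAlgebra.algebraMapInv (R := R) (M := M)).toLinearMap ∘ₗ
    CliffordAlgebra.changeForm (Q := (0 : QuadraticForm R M)) (Q' := 0) (B := -B)
      (by ext x; simpa using hB x)

variable (B : LinearMap.BilinForm R M) (hB : B.IsAlt)

@[simp] lemma pfW_one : pfW B hB 1 = 1 := by
  simp [pfW]

lemma pfW_ι_mul (m : M) (x : ExteriorAlgebra R M) :
    pfW B hB (ExteriorAlgebra.ι R m * x) =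
      pfW B hB (CliffordAlgebra.contractLeft (B m) x) := by
  have h1 : ∀ z, (ExteriorAlgebra.algebraMapInv (R := R) (M := M))
      (ExteriorAlgebra.ι R m * z) = 0 := fun z => by
    simp [ExteriorAlgebra.algebraMapInv]
  have h2 := CliffordAlgebra.changeForm_ι_mul (Q := (0 : QuadraticForm R M)) (Q' := 0) (B := -B)
      (by ext x; simpa using hB x) m x
  have h3 := CliffordAlgebra.changeForm_contractLeft (Q := (0 : QuadraticForm R M)) (Q' := 0)
      (B := -B) (by ext x; simpa using hB x) (B m) x
  simp only [pfW, LinearMap.comp_apply, AlgHom.toLinearMap_apply]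
  erw [h2]
  rw [map_sub]
  erw [h1]
  erw [h3]
  simp

lemma contractLeft_wedge (d : Module.Dual R M) (v : X → M) (L : List X) :
    CliffordAlgebra.contractLeft d (wedge (R := R) v L) =
      ∑ i : Fin L.length, ((-1) ^ (i : ℕ) * d (v (L.get i))) • wedge v (L.eraseIdx i) := by
  induction L with
  | nil => simp [wedge]
  | cons a l ih =>
    rw [wedge_cons]
    erw [CliffordAlgebra.contractLeft_ι_mul]
    rw [ih]
    erw [Fin.sum_univ_succ]
    simp only [Finset.mul_sum, Fin.val_zero, pow_zero, one_mul, List.eraseIdx_zero, List.tail_cons,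
      Fin.val_succ, List.eraseIdx_cons_succ, sub_eq_add_neg, ← Finset.sum_neg_distrib]
    congr 1
    refine Finset.sum_congr rfl fun i _ => ?_
    rw [wedge_cons, pow_succ, mul_smul_comm, ← neg_smul]
    simp [ExteriorAlgebra.ι]

lemma pfW_wedge (v : X → M) (L : List X) :
    pfW B hB (wedge v L) = pfL (fun x x' => B (v x) (v x')) L := by
  induction hn : L.length using Nat.strong_induction_on generalizing L with
  | _ n ih =>
    cases L with
    | nil => simp
    | cons a l =>
      rw [wedge_cons, pfW_ι_mul, contractLeft_wedge, pfL_cons, map_sum]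
      refine Finset.sum_congr rfl fun i _ => ?_
      rw [map_smul, ih _ _ _ rfl, smul_eq_mul]
      rw [List.length_eraseIdx_of_lt i.2, ← hn, List.length_cons]; lia

end Pfaffian

section Pfaffian2

variable {R S M X X' : Type*} [CommRing R] [CommRing S] [AddCommGroup M] [Module R M]

lemma wedge_perm (v : X → M) {L L' : List X} (h : L.Perm L') :
    wedge (R := R) v L = wedge v L' ∨ wedge (R := R) v L = -wedge v L' := by
  induction h with
  | nil => simp
  | cons x _ ih => rcases ih with h | h <;> simp [wedge_cons, h]
  | swap x y l =>
    right
    have := ExteriorAlgebra.ι_add_mul_swap (R := R) (v x) (v y)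
    rw [wedge_cons, wedge_cons, wedge_cons, wedge_cons, ← mul_assoc, ← mul_assoc,
      eq_neg_of_add_eq_zero_right this, neg_mul]
  | trans _ _ ih₁ ih₂ =>
    rcases ih₁ with h₁ | h₁ <;> rcases ih₂ with h₂ | h₂ <;> simp [h₁, h₂]

lemma wedge_eq_zero (v : X → M) {L : List X} (h : ¬L.Nodup) : wedge (R := R) v L = 0 := by
  rw [← List.exists_duplicate_iff_not_nodup] at h
  obtain ⟨a, ha⟩ := h
  obtain ⟨l, hl⟩ := (List.duplicate_iff_sublist.mp ha).exists_perm_append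
  have : wedge (R := R) v ([a, a] ++ l) = 0 := by
    simp [wedge_cons, ← mul_assoc]
  rcases wedge_perm (R := R) v hl with h | h <;> simp only [h, this, neg_zero]

/-- A pairing `y` is alternating if `y a a = 0` and `y a b = -y b a`. -/
def IsAltPairing (y : X → X → R) : Prop := (∀ a, y a a = 0) ∧ ∀ a b, y a b = -y b a

/-- The bilinear form on the free module with basis `X` extending the pairing `y`. -/
def pairForm (y : X → X → R) : LinearMap.BilinForm R (X →₀ R) :=
  Finsupp.linearCombination R fun a => Finsupp.linearCombination R (y a)

@[simp] lemma pairForm_single (y : X → X → R) (a b : X) :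
    pairForm y (Finsupp.single a 1) (Finsupp.single b 1) = y a b := by simp [pairForm]

lemma pairForm_isAlt {y : X → X → R} (hy : IsAltPairing y) : (pairForm y).IsAlt := by
  have hf : ∀ m m', pairForm y m m' = -pairForm y m' m := by
    have : pairForm y = -(pairForm y).flip := by
      ext a b
      simpa using hy.2 a b
    exact fun m m' => LinearMap.congr_fun₂ this m m'
  intro m
  induction m using Finsupp.induction_linear with
  | zero => simp
  | add f g hf' hg => simp [hf', hg, hf f g]
  | single a r => simp [pairForm, hy.1]

variable {y : X → X → R}

lemma pfL_eq_pfW (hy : IsAltPairing y) (L : List X) : pfL y L =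
    pfW (pairForm y) (pairForm_isAlt hy) (wedge (fun a => Finsupp.single a 1) L) := by
  rw [pfW_wedge]; simp

lemma pfL_perm (hy : IsAltPairing y) {L L' : List X} (h : L.Perm L') :
    pfL y L = pfL y L' ∨ pfL y L = -pfL y L' := by
  rw [pfL_eq_pfW hy, pfL_eq_pfW hy]
  rcases wedge_perm (R := R) (fun a : X => Finsupp.single a (1 : R)) h with h | h <;> simp [h]

lemma pfL_eq_zero_of_not_nodup (hy : IsAltPairing y) {L : List X} (h : ¬L.Nodup) : pfL y L = 0 := by
  rw [pfL_eq_pfW hy, wedge_eq_zero _ h, map_zero]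

lemma pfL_eq_zero_of_odd (y : X → X → R) {L : List X} (h : Odd L.length) : pfL y L = 0 := by
  induction hn : L.length using Nat.strong_induction_on generalizing L with
  | _ n ih =>
    cases L with
    | nil => simp at h
    | cons a l =>
      rw [pfL_cons]
      refine Finset.sum_eq_zero fun i _ => ?_
      have hi := i.2
      have hl := List.length_eraseIdx_of_lt hi
      rw [ih _ ?_ ?_ rfl, mul_zero]
      · rw [hl, ← hn, List.length_cons]; lia
      · rw [hl]
        rw [List.length_cons] at h
        grind

/-- The orthogonal sum of two copies of a pairing. -/
def sumPairing (y : X → X → R) : X ⊕ X → X ⊕ X → R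
  | .inl a, .inl b => y a b
  | .inr a, .inr b => y a b
  | _, _ => 0

lemma isAltPairing_sumPairing (hy : IsAltPairing y) : IsAltPairing (sumPairing y) := by
  constructor
  · rintro (a | a) <;> simp [sumPairing, hy.1]
  · rintro (a | a) (b | b) <;> simp [sumPairing, hy.2 a b]

lemma pfL_sumPairing_append (y : X → X → R) (L L' : List X) :
    pfL (sumPairing y) (L.map .inl ++ L'.map .inr) = pfL y L * pfL y L' := by
  induction hn : L.length using Nat.strong_induction_on generalizing L with
  | _ n ih =>
    cases L with
    | nil => simp [pfL_map, sumPairing]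
    | cons a l =>
      rw [List.map_cons, List.cons_append, pfL_cons, pfL_cons]
      have e : (l.map Sum.inl ++ L'.map Sum.inr : List (X ⊕ X)).length = l.length + L'.length := by
        simp
      rw [Fintype.sum_equiv (finCongr e) _ (fun i => (-1) ^ (i : ℕ) *
        sumPairing y (.inl a) ((l.map Sum.inl ++ L'.map Sum.inr).get (i.cast e.symm)) *
        pfL (sumPairing y) ((l.map Sum.inl ++ L'.map Sum.inr).eraseIdx i)) (fun i => by simp),
        Fin.sum_univ_add, Finset.sum_mul]
      rw [add_eq_left.mpr]
      · refine Finset.sum_congr rfl fun i _ => ?_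
        have hi := i.2
        have hl := List.length_eraseIdx_of_lt hi
        rw [List.length_cons] at hn
        have h1 : (l.map Sum.inl ++ L'.map Sum.inr : List (X ⊕ X)).eraseIdx
            (Fin.castAdd L'.length i) =
            (l.eraseIdx i).map Sum.inl ++ L'.map Sum.inr := by
          rw [List.eraseIdx_append_of_lt_length (by simp), List.eraseIdx_map]; simp
        rw [h1, ih _ (by lia) _ rfl]
        simp [sumPairing, mul_assoc]
      · refine Finset.sum_eq_zero fun i _ => ?_
        simp [sumPairing]

lemma perm_map_ite [DecidableEq X] (s : Finset X) (γ : List X) :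
    (γ.map fun c => if c ∈ s then (Sum.inl c : X ⊕ X) else Sum.inr c).Perm
      ((γ.filter (· ∈ s)).map .inl ++ (γ.filter (· ∉ s)).map .inr) := by
  induction γ with
  | nil => simp
  | cons c γ ih =>
    by_cases hc : c ∈ s
    · simpa [hc] using ih
    · simp only [hc, List.map_cons, if_false, not_false_eq_true, decide_true,
        List.filter_cons_of_pos, decide_false, Bool.false_eq_true, List.filter_cons_of_neg]
      exact (List.Perm.cons _ ih).trans List.perm_middle.symm

/-- The Pfaffian of a word in two orthogonal copies of an alphabet. -/
lemma pfL_sumPairing_ite [DecidableEq X] (hy : IsAltPairing y) (s : Finset X) (α γ β : List X) :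
    pfL (sumPairing y) (α.map .inl ++ (γ.map fun c => if c ∈ s then .inl c else .inr c) ++
      β.map .inr) = pfL y (α ++ γ.filter (· ∈ s)) * pfL y (γ.filter (· ∉ s) ++ β) ∨
    pfL (sumPairing y) (α.map .inl ++ (γ.map fun c => if c ∈ s then .inl c else .inr c) ++
      β.map .inr) = -(pfL y (α ++ γ.filter (· ∈ s)) * pfL y (γ.filter (· ∉ s) ++ β)) := by
  rw [← pfL_sumPairing_append]
  refine pfL_perm (isAltPairing_sumPairing hy) ?_
  rw [List.map_append, List.map_append, ← List.append_assoc]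
  refine List.Perm.append_right _ ?_
  rw [List.append_assoc]
  exact List.Perm.append_left _ (perm_map_ite s γ)

/-- The Pfaffian attached to a finite set of indices. -/
def pfS (y : ℕ → ℕ → R) (I : Finset ℕ) : R := pfL y (I.sort (· ≤ ·))

@[simp] lemma pfS_empty (y : ℕ → ℕ → R) : pfS y ∅ = 1 := by simp [pfS]

lemma pfL_eq_pfS {y : ℕ → ℕ → R} (hy : IsAltPairing y) {L : List ℕ} (h : L.Nodup) :
    pfL y L = pfS y L.toFinset ∨ pfL y L = -pfS y L.toFinset := by
  refine pfL_perm hy ?_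
  rw [List.perm_ext_iff_of_nodup h (Finset.sort_nodup _ _)]
  simp

lemma pfS_eq_zero_of_odd (y : ℕ → ℕ → R) {I : Finset ℕ} (h : Odd I.card) : pfS y I = 0 :=
  pfL_eq_zero_of_odd y (by simpa using h)

/-- Noncommutative binomial expansion of a product of sums. -/
lemma prod_smul_add {E : Type*} [Ring E] [Algebra R E] [DecidableEq X] (u : R) (p q : X → E)
    {γ : List X} (h : γ.Nodup) : (γ.map fun c => u • p c + q c).prod =
      ∑ s ∈ γ.toFinset.powerset,
        u ^ s.card • (γ.map fun c => if c ∈ s then p c else q c).prod := by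
  induction γ with
  | nil => simp
  | cons c γ ih =>
    rw [List.nodup_cons] at h
    have hc : c ∉ γ.toFinset := by simpa using h.1
    rw [List.map_cons, List.prod_cons, ih h.2, List.toFinset_cons, Finset.sum_powerset_insert hc,
      add_mul, add_comm, Finset.mul_sum, Finset.mul_sum]
    congr 1
    · refine Finset.sum_congr rfl fun s hs => ?_
      have hcs : c ∉ s := fun h' => hc (Finset.mem_powerset.mp hs h')
      simp [hcs]
    · refine Finset.sum_congr rfl fun s hs => ?_
      have hcs : c ∉ s := fun h' => hc (Finset.mem_powerset.mp hs h')
      have h2 : (γ.map fun d => if d ∈ insert c s then p d else q d) =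
          γ.map fun d => if d ∈ s then p d else q d := by
        refine List.map_congr_left fun d hd => ?_
        have : d ≠ c := fun h' => h.1 (h' ▸ hd)
        simp [this]
      rw [List.map_cons, List.prod_cons, h2, Finset.card_insert_of_notMem hcs]
      simp [pow_succ', smul_smul, mul_comm]

end Pfaffian2

section Straightening

open Polynomial

/-- A Pfaffian with many letters whose mutual pairings are divisible by `D` is divisible by a high
power of `D`. -/
lemma pow_dvd_pfL {R X : Type*} [CommRing R] (D : R) (y : X → X → R) (w : X → ℤ)
    (hw : ∀ a, w a = 1 ∨ w a = -1) (hD : ∀ a b, w a = 1 → w b = 1 → D ∣ y a b)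
    (L : List X) (N : ℕ) (hN : 2 * (N : ℤ) ≤ (L.map w).sum + 1) : D ^ N ∣ pfL y L := by
  induction hn : L.length using Nat.strong_induction_on generalizing L N with
  | _ n ih =>
    cases N with
    | zero => simp
    | succ N =>
    cases L with
    | nil => simp at hN; lia
    | cons a l =>
      rw [pfL_cons]
      refine Finset.dvd_sum fun i _ => ?_
      have hi := i.2
      have hp : w l[(i : ℕ)] + ((l.eraseIdx i).map w).sum = (l.map w).sum := by
        have := ((List.getElem_cons_eraseIdx_perm hi).map w).sum_eq
        simpa using this
      have hlt : (l.eraseIdx i).length < n := by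
        rw [List.length_eraseIdx_of_lt hi, ← hn, List.length_cons]; lia
      rw [List.map_cons, List.sum_cons] at hN
      simp only [List.get_eq_getElem]
      push_cast at hN
      by_cases h : w a = 1 ∧ w l[(i : ℕ)] = 1
      · rw [pow_succ', mul_assoc]
        refine Dvd.dvd.mul_left ?_ _
        refine mul_dvd_mul (hD _ _ h.1 h.2) (ih _ hlt _ _ ?_ rfl)
        lia
      · refine Dvd.dvd.mul_left (ih _ hlt _ _ ?_ rfl) _
        have h1 := hw a
        have h2 := hw l[(i : ℕ)]
        push_cast
        lia

lemma sum_lt_sum_of_card_eq {s t : Finset ℕ} (x : ℕ) (hc : s.card = t.card) (hne : s ≠ t)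
    (hs : ∀ i ∈ s, i ∉ t → i < x) (ht : ∀ i ∈ t, i ∉ s → x ≤ i) : ∑ i ∈ s, i < ∑ i ∈ t, i := by
  have hI : (t \ s).card = (s \ t).card := Finset.card_sdiff_comm hc.symm
  have hne' : (t \ s).Nonempty := by
    rw [Finset.nonempty_iff_ne_empty, Ne, Finset.sdiff_eq_empty_iff_subset]
    intro hsub
    exact hne (Finset.eq_of_subset_of_card_le hsub hc.le).symm
  have e1 := Finset.sum_inter_add_sum_sdiff s t (fun i => i)
  have e2 := Finset.sum_inter_add_sum_sdiff t s (fun i => i)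
  rw [Finset.inter_comm] at e2
  have b1 : ∑ i ∈ s \ t, (i + 1) ≤ (s \ t).card • x := by
    refine Finset.sum_le_card_nsmul _ _ _ fun i hi => ?_
    rw [Finset.mem_sdiff] at hi
    exact hs i hi.1 hi.2
  have b2 : (t \ s).card • x ≤ ∑ i ∈ t \ s, i := by
    refine Finset.card_nsmul_le_sum _ _ _ fun i hi => ?_
    rw [Finset.mem_sdiff] at hi
    exact ht i hi.1 hi.2
  rw [Finset.sum_add_distrib, Finset.sum_const, smul_eq_mul, mul_one, ← hI] at b1
  have := hne'.card_pos
  lia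

variable {F A : Type*} [Field F] [CommRing A] [Algebra F A]

/-- If a polynomial divisible by `(X ^ 2 + 1) ^ N` has its coefficients outside a window of width at
most `2 * N` in a subspace, then all its coefficients lie there. -/
lemma coeff_mem_of_dvd (V : Submodule F A) (f : A[X]) (N m k : ℕ)
    (hdvd : (X ^ 2 + 1) ^ N ∣ f) (hmk : k < m + 2 * N)
    (hlow : ∀ i < m, f.coeff i ∈ V) (hhigh : ∀ i, k < i → f.coeff i ∈ V) (i : ℕ) :
    f.coeff i ∈ V := by
  by_contra hi
  obtain ⟨l, hl, hV⟩ := Submodule.exists_le_ker_of_notMem hi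
  obtain ⟨g, rfl⟩ := hdvd
  let e : F[X] := ∑ j ∈ g.support, monomial j (l (g.coeff j))
  have he : ∀ j, e.coeff j = l (g.coeff j) := by
    intro j
    by_cases hj : g.coeff j = 0 <;> simp [e, coeff_monomial, hj]
  have hc : ∀ j, (((X ^ 2 + 1) ^ N * e : F[X])).coeff j =
      l (((X ^ 2 + 1) ^ N * g : A[X]).coeff j) := by
    intro j
    have : ((X ^ 2 + 1) ^ N : A[X]) = ((X ^ 2 + 1) ^ N : F[X]).map (algebraMap F A) := by simp
    rw [this, coeff_mul, coeff_mul, map_sum]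
    refine Finset.sum_congr rfl fun p _ => ?_
    rw [coeff_map, ← Algebra.smul_def, map_smul, he, smul_eq_mul]
  set q : F[X] := (X ^ 2 + 1) ^ N with hq
  have hqm : q.Monic := by
    have : (X ^ 2 + 1 : F[X]) = X ^ 2 + C 1 := by simp
    rw [hq, this]
    exact (monic_X_pow_add_C 1 two_ne_zero).pow N
  have hqd : q.natDegree = 2 * N := by
    have : (X ^ 2 + 1 : F[X]) = X ^ 2 + C 1 := by simp
    rw [hq, this, natDegree_pow, natDegree_X_pow_add_C, mul_comm]
  have hqt : q.natTrailingDegree = 0 := by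
    rw [natTrailingDegree_eq_zero]
    right
    simp [hq, coeff_zero_eq_eval_zero]
  have hqe : q * e ≠ 0 := by
    intro h
    apply hl
    rw [← hc, h, coeff_zero]
  have he0 : e ≠ 0 := right_ne_zero_of_mul hqe
  have h1 : (q * e).natDegree = 2 * N + e.natDegree := by
    rw [natDegree_mul hqm.ne_zero he0, hqd]
  have h2 : (q * e).natTrailingDegree = e.natTrailingDegree := by
    rw [natTrailingDegree_mul hqm.ne_zero he0, hqt, zero_add]
  have h3 := natTrailingDegree_le_natDegree e
  have h4 : (q * e).natDegree ≤ k := by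
    by_contra h
    push Not at h
    have := leadingCoeff_ne_zero.mpr hqe
    rw [leadingCoeff, hc] at this
    exact this (hV (hhigh _ h))
  have h5 : m ≤ (q * e).natTrailingDegree := by
    by_contra h
    push Not at h
    have := trailingCoeff_nonzero_iff_nonzero.mpr hqe
    rw [trailingCoeff, hc] at this
    exact this (hV (hlow _ h))
  lia

/-- The vectors of the generic exchange: letters of kind `0` lie in the first copy, letters of kind
`2` in the second, the others are spread over both. -/
def exchangeVec (A : Type*) [CommRing A] : Fin 3 × ℕ → (ℕ ⊕ ℕ →₀ A[X])
  | (0, a) => .single (.inl a) 1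
  | (1, a) => (X : A[X]) • .single (.inl a) 1 + .single (.inr a) 1
  | (2, a) => .single (.inr a) 1

lemma exists_exchange_poly {y : ℕ → ℕ → A} (hy : IsAltPairing y) (α γ β : List ℕ)
    (hγ : γ.Nodup) (N : ℕ) (hN : 2 * N + α.length + β.length ≤ γ.length + 1) :
    ∃ f : A[X], (X ^ 2 + 1) ^ N ∣ f ∧ ∀ k, f.coeff k =
      ∑ s ∈ γ.toFinset.powerset with s.card = k, pfL (sumPairing y)
        (α.map .inl ++ (γ.map fun c => if c ∈ s then .inl c else .inr c) ++ β.map .inr) := by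
  set z : ℕ → ℕ → A[X] := fun a b => C (y a b) with hz
  have hza : IsAltPairing z := ⟨fun a => by simp [hz, hy.1], fun a b => by simp [hz, hy.2 a b]⟩
  have hzs := isAltPairing_sumPairing hza
  set B := pairForm (sumPairing z)
  have hB : B.IsAlt := pairForm_isAlt hzs
  set v := exchangeVec A
  set word : List (Fin 3 × ℕ) := α.map (Prod.mk 0) ++ γ.map (Prod.mk 1) ++ β.map (Prod.mk 2)
  refine ⟨pfW B hB (wedge v word), ?_, fun k => ?_⟩
  · rw [pfW_wedge]
    refine pow_dvd_pfL _ _ (fun p => if p.1 = 1 then 1 else -1) (fun a => by split_ifs <;> simp)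
      ?_ _ _ ?_
    · rintro ⟨a, i⟩ ⟨b, j⟩ ha hb
      obtain rfl : a = 1 := by by_contra h; simp [h] at ha
      obtain rfl : b = 1 := by by_contra h; simp [h] at hb
      refine ⟨z i j, ?_⟩
      simp only [v, exchangeVec, map_add, LinearMap.add_apply, map_smul, LinearMap.smul_apply, B,
        pairForm_single, sumPairing, smul_eq_mul]
      ring
    · simp [word, Function.comp_def]
      lia
  · have hexp : wedge (R := A[X]) v word = ∑ s ∈ γ.toFinset.powerset, (X : A[X]) ^ s.card •
        wedge (fun a => Finsupp.single a (1 : A[X]))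
          (α.map .inl ++ (γ.map fun c => if c ∈ s then .inl c else .inr c) ++ β.map .inr) := by
      have := prod_smul_add (X : A[X])
        (fun c => ExteriorAlgebra.ι A[X] (Finsupp.single (Sum.inl c : ℕ ⊕ ℕ) (1 : A[X])))
        (fun c => ExteriorAlgebra.ι A[X] (Finsupp.single (Sum.inr c : ℕ ⊕ ℕ) (1 : A[X]))) hγ
      simp only [word, wedge_append]
      have h1 : wedge (R := A[X]) v (γ.map (Prod.mk 1)) = (γ.map fun c => (X : A[X]) •
        ExteriorAlgebra.ι A[X] (Finsupp.single (Sum.inl c : ℕ ⊕ ℕ) (1 : A[X])) +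
        ExteriorAlgebra.ι A[X] (Finsupp.single (Sum.inr c : ℕ ⊕ ℕ) (1 : A[X]))).prod := by
        simp only [wedge, List.map_map, Function.comp_def, v, exchangeVec, map_add, map_smul]
      rw [h1, this, Finset.mul_sum, Finset.sum_mul]
      refine Finset.sum_congr rfl fun s _ => ?_
      rw [mul_smul_comm, smul_mul_assoc]
      congr 1
      simp only [wedge, List.map_map, Function.comp_def, v, exchangeVec]
      congr 4
      ext c
      split_ifs <;> rfl
    rw [hexp, map_sum, finsetSum_coeff, Finset.sum_filter]
    refine Finset.sum_congr rfl fun s _ => ?_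
    rw [map_smul, ← pfL_eq_pfW hzs, smul_eq_mul]
    have : ∀ L, pfL (sumPairing z) L = C (pfL (sumPairing y) L) := by
      intro L
      rw [map_pfL]
      congr 1
      ext a b : 2
      rcases a with a | a <;> rcases b with b | b <;> simp [sumPairing, hz]
    rw [this, X_pow_mul_C, coeff_C_mul_X_pow]
    simp only [eq_comm]

/-- The number of elements of `I` below `x`. -/
def cnt (I : Finset ℕ) (x : ℕ) : ℕ := (I.filter (· < x)).card

/-- The products of two Pfaffians which are larger than `I, J` for straightening purposes. -/
def exchangeSpan (F : Type*) [Field F] [Algebra F A] (y : ℕ → ℕ → A) (I J : Finset ℕ) :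
    Submodule F A :=
  Submodule.span F {z | ∃ I' J' : Finset ℕ, z = pfS y I' * pfS y J' ∧
    I'.val + J'.val = I.val + J.val ∧
    (I.card < I'.card ∨ I.card < J'.card ∨
      (I'.card = I.card ∧ ∑ i ∈ I', i < ∑ i ∈ I, i))}

lemma pfS_mul_pfS_mem {y : ℕ → ℕ → A} (hy : IsAltPairing y) (I J : Finset ℕ)
    (hIJ : J.card ≤ I.card) (x : ℕ) (hx : cnt I x < cnt J x) :
    pfS y I * pfS y J ∈ exchangeSpan F y I J := by
  set α := (I.filter (· < x)).sort (· ≤ ·) with hα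
  set β := (J.filter (¬ · < x)).sort (· ≤ ·) with hβ
  set I₂ := I.filter (¬ · < x) with hI₂
  set J₁ := J.filter (· < x) with hJ₁
  set γ := I₂.sort (· ≤ ·) ++ J₁.sort (· ≤ ·) with hγd
  have hγ : γ.Nodup := by
    rw [List.nodup_append']
    refine ⟨Finset.sort_nodup _ _, Finset.sort_nodup _ _, fun a ha hb => ?_⟩
    simp [hI₂, hJ₁] at ha hb
    lia
  have hγs : γ.toFinset = I₂ ∪ J₁ := by ext; simp [hγd]
  have lα : α.length = cnt I x := by simp [hα, cnt]
  have lβ : β.length + cnt J x = J.card := by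
    rw [hβ, Finset.length_sort, cnt, add_comm, Finset.card_filter_add_card_filter_not]
  have lI : I₂.card + cnt I x = I.card := by
    rw [cnt, add_comm, Finset.card_filter_add_card_filter_not]
  have lγ : γ.length = I₂.card + cnt J x := by simp [hγd, cnt, hJ₁]
  have hval : (α : Multiset ℕ) + (γ : Multiset ℕ) + (β : Multiset ℕ) = I.val + J.val := by
    rw [hγd, ← Multiset.coe_add, hα, hβ, Finset.sort_eq, Finset.sort_eq, Finset.sort_eq,
      Finset.sort_eq, hI₂, hJ₁, Finset.filter_val, Finset.filter_val, Finset.filter_val,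
      Finset.filter_val]
    conv_rhs => rw [← Multiset.filter_add_not (· < x) I.val,
      ← Multiset.filter_add_not (· < x) J.val]
    abel
  set m := cnt J x + β.length - cnt I x with hm
  set w := I₂.card + 1 - m with hw
  obtain ⟨f, hf, hcoeff⟩ := exists_exchange_poly hy α γ β hγ ((w + 1) / 2) (by lia)
  set g : Finset ℕ → A := fun s => pfL (sumPairing y)
        (α.map .inl ++ (γ.map fun c => if c ∈ s then .inl c else .inr c) ++ β.map .inr) with hg
  set V := exchangeSpan F y I J with hV
  have key : ∀ s ∈ γ.toFinset.powerset,
      (I₂.card < s.card ∨ s.card < m ∨ (s.card = I₂.card ∧ s ≠ I₂)) → g s ∈ V := by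
    intro s hs hcond
    have hs' := Finset.mem_powerset.mp hs
    set L₁ := α ++ γ.filter (· ∈ s) with hL₁
    set L₂ := γ.filter (· ∉ s) ++ β with hL₂
    have hgs : g s = pfL y L₁ * pfL y L₂ ∨ g s = -(pfL y L₁ * pfL y L₂) :=
      pfL_sumPairing_ite hy s α γ β
    suffices pfL y L₁ * pfL y L₂ ∈ V by
      rcases hgs with h | h <;> rw [h]
      · exact this
      · exact V.neg_mem this
    by_cases n₁ : L₁.Nodup
    swap
    · rw [pfL_eq_zero_of_not_nodup hy n₁, zero_mul]; exact V.zero_mem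
    by_cases n₂ : L₂.Nodup
    swap
    · rw [pfL_eq_zero_of_not_nodup hy n₂, mul_zero]; exact V.zero_mem
    have hmem : pfS y L₁.toFinset * pfS y L₂.toFinset ∈ V := by
      refine Submodule.subset_span ⟨_, _, rfl, ?_, ?_⟩
      · rw [List.toFinset_val, List.toFinset_val, n₁.dedup, n₂.dedup, ← hval, hL₁, hL₂,
          ← Multiset.coe_add, ← Multiset.coe_add]
        have := Multiset.filter_add_not (· ∈ s) (γ : Multiset ℕ)
        rw [Multiset.filter_coe, Multiset.filter_coe] at this
        rw [← this]
        abel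
      · have hfs : (γ.filter (· ∈ s)).toFinset = s := by
          ext a
          simp only [List.mem_toFinset, List.mem_filter, decide_eq_true_eq, and_iff_right_iff_imp]
          intro ha
          simpa using hs' ha
        have lf : (γ.filter (· ∈ s)).length = s.card := by
          rw [← List.toFinset_card_of_nodup (hγ.filter _), hfs]
        have lf2 : (γ.filter (· ∉ s)).length + s.card = γ.length := by
          have := List.length_eq_length_filter_add (l := γ) (· ∈ s)
          simp only [lf] at this
          rw [this, add_comm]
          simp
        rw [List.toFinset_card_of_nodup n₁, List.toFinset_card_of_nodup n₂, hL₁, hL₂,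
          List.length_append, List.length_append, lα, lf]
        rcases hcond with h | h | ⟨h, hne⟩
        · left; lia
        · right; left; lia
        · right; right
          refine ⟨by lia, ?_⟩
          have hdis : Disjoint (I.filter (· < x)) s := by
            rw [List.nodup_append'] at n₁
            rw [Finset.disjoint_left]
            intro a ha hb
            refine (List.disjoint_left.mp n₁.2.2) (by simpa [hα] using ha : a ∈ α) ?_
            simpa [hb] using hs' hb
          have : (α ++ γ.filter (· ∈ s)).toFinset = I.filter (· < x) ∪ s := by
            rw [List.toFinset_append, hfs]; simp [hα]
          rw [this, Finset.sum_union hdis, ← Finset.sum_filter_add_sum_filter_not I (· < x)]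
          refine Nat.add_lt_add_left ?_ _
          change ∑ i ∈ s, i < ∑ i ∈ I₂, i
          refine sum_lt_sum_of_card_eq x h hne (fun i hi hi' => ?_) (fun i hi _ => ?_)
          · have := hs' hi
            rw [hγs, Finset.mem_union] at this
            have := this.resolve_left hi'
            simp [hJ₁] at this
            lia
          · simp [hI₂] at hi
            lia
    rcases pfL_eq_pfS hy n₁ with h₁ | h₁ <;> rcases pfL_eq_pfS hy n₂ with h₂ | h₂ <;>
      rw [h₁, h₂] <;> simpa using hmem
  have hmain : f.coeff I₂.card ∈ V := by
    refine coeff_mem_of_dvd V f ((w + 1) / 2) m I₂.card hf (by lia) (fun i hi => ?_)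
      (fun i hi => ?_) _
    · rw [hcoeff]
      refine V.sum_mem fun s hs => ?_
      rw [Finset.mem_filter] at hs
      exact key s hs.1 (Or.inr (Or.inl (by lia)))
    · rw [hcoeff]
      refine V.sum_mem fun s hs => ?_
      rw [Finset.mem_filter] at hs
      exact key s hs.1 (Or.inl (by lia))
  rw [hcoeff, ← Finset.add_sum_erase _ _ (a := I₂)] at hmain
  swap
  · rw [Finset.mem_filter, Finset.mem_powerset, hγs]
    exact ⟨Finset.subset_union_left, rfl⟩
  have hI₂V : g I₂ ∈ V := by
    refine (Submodule.add_mem_iff_left _ ?_).mp hmain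
    refine V.sum_mem fun s hs => ?_
    rw [Finset.mem_erase, Finset.mem_filter] at hs
    exact key s hs.2.1 (Or.inr (Or.inr ⟨hs.2.2, hs.1⟩))
  have hfil : γ.filter (· ∈ I₂) = I₂.sort (· ≤ ·) := by
    rw [hγd, List.filter_append, List.filter_eq_self.mpr, List.filter_eq_nil_iff.mpr,
      List.append_nil]
    · intro a ha
      simp [hI₂, hJ₁] at ha ⊢
      lia
    · intro a ha
      simpa using ha
  have hfil' : γ.filter (· ∉ I₂) = J₁.sort (· ≤ ·) := by
    rw [hγd, List.filter_append, List.filter_eq_nil_iff.mpr, List.filter_eq_self.mpr,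
      List.nil_append]
    · intro a ha
      simp [hI₂, hJ₁] at ha ⊢
      lia
    · intro a ha
      simpa using ha
  have hgI := pfL_sumPairing_ite hy I₂ α γ β
  rw [hfil, hfil'] at hgI
  have nodup_aux : ∀ K : Finset ℕ, ((K.filter (· < x)).sort (· ≤ ·) ++
      (K.filter (¬ · < x)).sort (· ≤ ·)).Nodup := by
    intro K
    rw [List.nodup_append']
    refine ⟨Finset.sort_nodup _ _, Finset.sort_nodup _ _, fun a ha hb => ?_⟩
    simp at ha hb
    lia
  have fin_aux : ∀ K : Finset ℕ, ((K.filter (· < x)).sort (· ≤ ·) ++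
      (K.filter (¬ · < x)).sort (· ≤ ·)).toFinset = K := by
    intro K
    ext a
    have := lt_or_ge a x
    simp
    tauto
  have hPI := pfL_eq_pfS hy (nodup_aux I)
  have hPJ := pfL_eq_pfS hy (nodup_aux J)
  rw [fin_aux] at hPI hPJ
  change g I₂ = _ ∨ g I₂ = _ at hgI
  have hfin : pfL y (α ++ I₂.sort (· ≤ ·)) * pfL y (J₁.sort (· ≤ ·) ++ β) ∈ V := by
    rcases hgI with h | h <;> rw [h] at hI₂V
    · exact hI₂V
    · simpa using hI₂V
  rcases hPI with h₁ | h₁ <;> rcases hPJ with h₂ | h₂ <;> rw [h₁, h₂] at hfin <;>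
    simpa using hfin

end Straightening

section SymplecticRelation

/-- The double contraction by an isotropic bivector vanishes. -/
lemma sum_contractLeft_contractLeft {R M κ : Type*} [CommRing R] [AddCommGroup M] [Module R M]
    (s : Finset κ) (d d' : κ → Module.Dual R M)
    (h : ∀ m m', ∑ p ∈ s, (d p m * d' p m' - d' p m * d p m') = 0) (x : ExteriorAlgebra R M) :
    ∑ p ∈ s, CliffordAlgebra.contractLeft (d' p) (CliffordAlgebra.contractLeft (d p) x) = 0 := by
  induction x using CliffordAlgebra.left_induction with
  | algebraMap r => simp [CliffordAlgebra.contractLeft_algebraMap]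
  | add x y hx hy => simp [Finset.sum_add_distrib, hx, hy]
  | ι_mul x m hx =>
    have h0 : ∑ p ∈ s, (d p m • d' p - d' p m • d p) = 0 := by
      ext m'
      simpa using h m m'
    have h1 := congrArg
      (fun f => CliffordAlgebra.contractLeft (Q := (0 : QuadraticForm R M)) f x) h0
    simp only [map_sum, map_sub, map_smul, LinearMap.coe_sum, Finset.sum_apply,
      LinearMap.sub_apply, LinearMap.smul_apply, map_zero, LinearMap.zero_apply] at h1
    simp only [CliffordAlgebra.contractLeft_ι_mul, map_sub, map_smul, Finset.sum_sub_distrib,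
      ← Finset.mul_sum, hx] at h1 ⊢
    simpa using h1

variable {F A : Type*} [Field F] [CommRing A] [Algebra F A]

/-- The relations satisfied by the entries of the generic matrix of `V`, the indices being ordered
as `1̄ ≺ 1 ≺ 2̄ ≺ 2 ≺ ⋯`. -/
structure SympRel (r : ℕ) (y : ℕ → ℕ → A) : Prop where
  alt : IsAltPairing y
  isotropic : ∀ a b, ∑ p ∈ Finset.range r,
    (y a (2 * p) * y (2 * p + 1) b - y a (2 * p + 1) * y (2 * p) b) = 0
  trace : ∑ p ∈ Finset.range r, y (2 * p) (2 * p + 1) = 0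

variable {r : ℕ} {y : ℕ → ℕ → A}

/-- The bivector of the pair `2 * p, 2 * p + 1`. -/
def pairVec (A : Type*) [CommRing A] (p : ℕ) : ExteriorAlgebra A (ℕ →₀ A) :=
  ExteriorAlgebra.ι A (.single (2 * p) 1) * ExteriorAlgebra.ι A (.single (2 * p + 1) 1)

lemma SympRel.pfW_sum_pairVec_mul (h : SympRel r y) (x : ExteriorAlgebra A (ℕ →₀ A)) :
    ∑ p ∈ Finset.range r, pfW (pairForm y) (pairForm_isAlt h.alt) (pairVec A p * x) = 0 := by
  set B := pairForm y
  set e : ℕ → (ℕ →₀ A) := fun a => .single a 1 with he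
  have h0 : ∀ m m', ∑ p ∈ Finset.range r,
      (B (e (2 * p)) m * B (e (2 * p + 1)) m' - B (e (2 * p + 1)) m * B (e (2 * p)) m') = 0 := by
    have : ∑ p ∈ Finset.range r, ((LinearMap.mul A A).compl₁₂ (B (e (2 * p))) (B (e (2 * p + 1)))
        - (LinearMap.mul A A).compl₁₂ (B (e (2 * p + 1))) (B (e (2 * p)))) = 0 := by
      ext a b
      have := h.isotropic a b
      simp only [h.alt.2 a] at this
      simp only [neg_mul, sub_neg_eq_add] at this
      simp only [LinearMap.coe_comp, Function.comp_apply, LinearMap.coe_sum, Finset.sum_apply,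
        LinearMap.sub_apply, LinearMap.compl₁₂_apply, LinearMap.mul_apply', Finsupp.lsingle_apply,
        he, B, pairForm_single, LinearMap.zero_apply, LinearMap.zero_comp]
      rw [← neg_eq_zero, ← this, ← Finset.sum_neg_distrib]
      exact Finset.sum_congr rfl fun p _ => by ring
    intro m m'
    have := LinearMap.congr_fun₂ this m m'
    simpa using this
  have h1 := sum_contractLeft_contractLeft (Finset.range r) (fun p => B (e (2 * p)))
    (fun p => B (e (2 * p + 1))) h0 x
  have h2 : ∀ p, pfW B (pairForm_isAlt h.alt) (pairVec A p * x) =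
      y (2 * p) (2 * p + 1) * pfW B (pairForm_isAlt h.alt) x -
        pfW B (pairForm_isAlt h.alt) (CliffordAlgebra.contractLeft (B (e (2 * p + 1)))
          (CliffordAlgebra.contractLeft (B (e (2 * p))) x)) := by
    intro p
    rw [pairVec, mul_assoc, pfW_ι_mul]
    erw [CliffordAlgebra.contractLeft_ι_mul]
    rw [map_sub, map_smul, ← pfW_ι_mul, smul_eq_mul]
    simp only [B, e, pairForm_single]
  rw [Finset.sum_congr rfl fun p _ => h2 p, Finset.sum_sub_distrib, ← Finset.sum_mul, h.trace,
    ← map_sum]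
  erw [h1]
  simp

lemma commute_pairVec (p q : ℕ) : Commute (pairVec A p) (pairVec A q) := by
  have key : ∀ a b c : ℕ →₀ A, Commute (ExteriorAlgebra.ι A a * ExteriorAlgebra.ι A b)
      (ExteriorAlgebra.ι A c) := by
    intro a b c
    have h1 := eq_neg_of_add_eq_zero_left (ExteriorAlgebra.ι_add_mul_swap (R := A) b c)
    have h2 := eq_neg_of_add_eq_zero_left (ExteriorAlgebra.ι_add_mul_swap (R := A) a c)
    rw [commute_iff_eq, mul_assoc, h1, mul_neg, ← mul_assoc, h2, neg_mul, neg_neg, mul_assoc]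
  exact (key _ _ _).mul_right (key _ _ _)

/-- The word of the pairs `2 * p, 2 * p + 1`, for `p` in `Γ`. -/
def pairWord (Γ : Finset ℕ) : List ℕ := Γ.toList.flatMap fun p => [2 * p, 2 * p + 1]

lemma wedge_pairWord (Γ : Finset ℕ) :
    wedge (R := A) (fun a => Finsupp.single a (1 : A)) (pairWord Γ) =
      (Γ.toList.map (pairVec A)).prod := by
  rw [pairWord]
  induction Γ.toList with
  | nil => simp
  | cons p l ih => simp [ih, wedge_cons, pairVec, mul_assoc]

lemma mem_pairWord {Γ : Finset ℕ} {i : ℕ} : i ∈ pairWord Γ ↔ i / 2 ∈ Γ := by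
  simp only [pairWord, List.mem_flatMap, Finset.mem_toList, List.mem_cons, List.not_mem_nil,
    or_false]
  constructor
  · rintro ⟨p, hp, h⟩
    rwa [show i / 2 = p by lia]
  · exact fun h => ⟨i / 2, h, by lia⟩

lemma length_pairWord (Γ : Finset ℕ) : (pairWord Γ).length = 2 * Γ.card := by
  rw [← Finset.length_toList, pairWord]
  induction Γ.toList with
  | nil => simp
  | cons p l ih => simp at ih ⊢; lia

lemma sum_pairWord (Γ : Finset ℕ) : ((pairWord Γ).map (· / 2)).sum = 2 * ∑ p ∈ Γ, p := by
  rw [pairWord, Finset.sum_eq_multiset_sum, Multiset.map_id', ← Multiset.sum_toList]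
  change _ = 2 * Γ.toList.sum
  induction Γ.toList with
  | nil => simp
  | cons p l ih =>
    simp only [List.flatMap_cons, List.map_append, List.sum_append, ih]
    simp
    lia

lemma nodup_pairWord (Γ : Finset ℕ) : (pairWord Γ).Nodup := by
  rw [pairWord, List.nodup_flatMap]
  refine ⟨fun p _ => by simp, Γ.nodup_toList.imp fun {a b} hab => ?_⟩
  simp [Function.onFun]
  lia

lemma SympRel.sum_pfL_insert (h : SympRel r y) (K : List ℕ) (Γ : Finset ℕ) :
    ∑ p ∈ Finset.range r \ Γ, pfL y (pairWord (insert p Γ) ++ K) = 0 := by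
  rw [← h.pfW_sum_pairVec_mul (wedge (fun a => Finsupp.single a 1) (pairWord Γ ++ K)),
    ← Finset.sum_subset Finset.sdiff_subset (s₂ := Finset.range r)]
  · refine Finset.sum_congr rfl fun p hp => ?_
    rw [Finset.mem_sdiff] at hp
    rw [pfL_eq_pfW h.alt, wedge_append, wedge_append, wedge_pairWord, wedge_pairWord, ← mul_assoc,
      ← List.prod_cons, ← List.map_cons]
    congr 2
    refine ((Finset.toList_insert hp.2).map _).prod_eq' ?_
    exact List.pairwise_map.mpr (List.pairwise_of_forall fun a b => commute_pairVec a b)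
  · intro p _ hp'
    have hp : p ∈ Γ := by
      by_contra hp
      exact hp' (Finset.mem_sdiff.mpr ⟨‹_›, hp⟩)
    have : pairVec A p * wedge (fun a => Finsupp.single a 1) (pairWord Γ ++ K) =
        wedge (fun a => Finsupp.single a 1) ([2 * p, 2 * p + 1] ++ (pairWord Γ ++ K)) := by
      simp [wedge_cons, pairVec, mul_assoc]
    rw [this, wedge_eq_zero, map_zero]
    intro hnd
    rw [List.nodup_append'] at hnd
    refine (List.disjoint_left.mp hnd.2.2) (by simp : 2 * p ∈ [2 * p, 2 * p + 1]) ?_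
    rw [List.mem_append, mem_pairWord]
    left
    simpa using hp

section Combinatorics

variable {E : Type*} [AddCommGroup E] [Module F E] {κ : Type*} [DecidableEq κ]

lemma sum_powersetCard_superset_eq_zero {U : Finset κ} {H : Finset κ → E}
    (hF : ∀ k : ℕ, 1 ≤ k → k ≤ U.card → (k : F) ≠ 0)
    (hH : ∀ Γ ⊆ U, ∑ p ∈ U \ Γ, H (insert p Γ) = 0) {S : Finset κ} {g : ℕ}
    (hg : S.card < g) (hgU : g ≤ U.card) :
    ∑ Γ ∈ U.powersetCard g with S ⊆ Γ, H Γ = 0 := by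
  have key : ((g - S.card : ℕ) : F) • ∑ Γ ∈ U.powersetCard g with S ⊆ Γ, H Γ =
      ∑ Γ ∈ U.powersetCard (g - 1) with S ⊆ Γ, ∑ p ∈ U \ Γ, H (insert p Γ) := by
    rw [Finset.smul_sum, Finset.sum_sigma']
    have : ∀ Γ ∈ (U.powersetCard g).filter (S ⊆ ·),
        ((g - S.card : ℕ) : F) • H Γ = ∑ p ∈ Γ \ S, H Γ := by
      intro Γ hΓ
      rw [Finset.mem_filter, Finset.mem_powersetCard] at hΓ
      rw [Finset.sum_const, Finset.card_sdiff_of_subset hΓ.2, hΓ.1.2, Nat.cast_smul_eq_nsmul]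
    rw [Finset.sum_congr rfl this, Finset.sum_sigma']
    refine Finset.sum_bij' (fun a _ => ⟨a.1.erase a.2, a.2⟩) (fun a _ => ⟨insert a.2 a.1, a.2⟩)
      ?_ ?_ ?_ ?_ ?_
    · rintro ⟨Γ, p⟩ h
      simp only [Finset.mem_sigma, Finset.mem_filter, Finset.mem_powersetCard,
        Finset.mem_sdiff] at h ⊢
      refine ⟨⟨⟨(Finset.erase_subset _ _).trans h.1.1.1, ?_⟩, ?_⟩, h.1.1.1 h.2.1, by simp⟩
      · rw [Finset.card_erase_of_mem h.2.1, h.1.1.2]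
      · exact Finset.subset_erase.mpr ⟨h.1.2, h.2.2⟩
    · rintro ⟨Γ, p⟩ h
      simp only [Finset.mem_sigma, Finset.mem_filter, Finset.mem_powersetCard,
        Finset.mem_sdiff] at h ⊢
      refine ⟨⟨⟨Finset.insert_subset h.2.1 h.1.1.1, ?_⟩, h.1.2.trans (Finset.subset_insert _ _)⟩,
        by simp, fun hS => h.2.2 (h.1.2 hS)⟩
      rw [Finset.card_insert_of_notMem h.2.2, h.1.1.2]
      lia
    · rintro ⟨Γ, p⟩ h
      simp only [Finset.mem_sigma, Finset.mem_sdiff] at h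
      simp [Finset.insert_erase h.2.1]
    · rintro ⟨Γ, p⟩ h
      simp only [Finset.mem_sigma, Finset.mem_sdiff] at h
      simp [Finset.erase_insert h.2.2]
    · rintro ⟨Γ, p⟩ h
      simp only [Finset.mem_sigma, Finset.mem_sdiff] at h
      simp [Finset.insert_erase h.2.1]
  rw [Finset.sum_eq_zero fun Γ hΓ => hH Γ ?_] at key
  · exact (smul_eq_zero.mp key).resolve_left (hF _ (by lia) (by lia))
  · rw [Finset.mem_filter, Finset.mem_powersetCard] at hΓ
    exact hΓ.1.1

lemma sum_powersetCard_disjoint_eq_zero {U : Finset κ} {H : Finset κ → E}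
    (hF : ∀ k : ℕ, 1 ≤ k → k ≤ U.card → (k : F) ≠ 0)
    (hH : ∀ Γ ⊆ U, ∑ p ∈ U \ Γ, H (insert p Γ) = 0) (S Z : Finset κ) {g : ℕ}
    (hg : S.card + Z.card < g) (hgU : g ≤ U.card) :
    ∑ Γ ∈ U.powersetCard g with S ⊆ Γ ∧ Disjoint Γ Z, H Γ = 0 := by
  induction Z using Finset.induction_on generalizing S with
  | empty =>
    simpa using sum_powersetCard_superset_eq_zero hF hH (by simpa using hg) hgU
  | insert z Z hz ih =>
    rw [Finset.card_insert_of_notMem hz] at hg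
    have h1 := ih S (by lia)
    have h2 := ih (insert z S) (by have := Finset.card_insert_le z S; lia)
    rw [← Finset.sum_filter_add_sum_filter_not _ (fun Γ => z ∈ Γ), Finset.filter_filter,
      Finset.filter_filter] at h1
    rw [Finset.filter_congr (q := fun Γ => insert z S ⊆ Γ ∧ Disjoint Γ Z) (fun Γ _ => by
      rw [Finset.insert_subset_iff]; tauto), h2, zero_add] at h1
    rw [← h1]
    refine Finset.sum_congr (Finset.filter_congr fun Γ _ => ?_) fun _ _ => rfl
    rw [Finset.disjoint_insert_right]
    tauto

end Combinatorics

/-- The half sum of a set of indices. -/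
def halfSum (I : Finset ℕ) : ℕ := ∑ i ∈ I, i / 2

/-- A set of indices is admissible if it has at most `q` elements below `2 * q`. -/
def Admissible (r : ℕ) (I : Finset ℕ) : Prop := ∀ q ≤ r, cnt I (2 * q) ≤ q

lemma cnt_two_mul (I : Finset ℕ) (q : ℕ) : cnt I (2 * q) +
    ((Finset.range q).filter fun p => 2 * p ∉ I ∧ 2 * p + 1 ∉ I).card =
    q + ((Finset.range q).filter fun p => 2 * p ∈ I ∧ 2 * p + 1 ∈ I).card := by
  induction q with
  | zero => simp [cnt]
  | succ q ih =>
    have h1 : cnt I (2 * (q + 1)) = cnt I (2 * q) + (if 2 * q ∈ I then 1 else 0) +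
        (if 2 * q + 1 ∈ I then 1 else 0) := by
      have : ∀ x, cnt I (x + 1) = cnt I x + if x ∈ I then 1 else 0 := by
        intro x
        have e : I.filter (· < x + 1) = I.filter (· < x) ∪ I.filter (· = x) := by
          ext; simp; lia
        rw [cnt, e, Finset.card_union_of_disjoint, cnt, Finset.filter_eq']
        · split_ifs <;> simp
        · rw [Finset.disjoint_left]
          intro a ha hb
          simp at ha hb
          lia
      rw [show 2 * (q + 1) = 2 * q + 1 + 1 by ring, this, this]
    rw [h1, Finset.range_add_one, Finset.filter_insert, Finset.filter_insert]
    by_cases h2 : 2 * q ∈ I <;> by_cases h3 : 2 * q + 1 ∈ I <;> simp [h2, h3] <;> lia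

/-- A Pfaffian which is not admissible is a combination of Pfaffians with larger half sum. -/
lemma SympRel.pfS_mem (h : SympRel r y) (hF : ∀ k : ℕ, 1 ≤ k → k ≤ r → (k : F) ≠ 0)
    {I : Finset ℕ} (hI : I ⊆ Finset.range (2 * r)) (hadm : ¬Admissible r I) :
    pfS y I ∈ Submodule.span F {z | ∃ I' ⊆ Finset.range (2 * r), z = pfS y I' ∧
      I'.card = I.card ∧ halfSum I < halfSum I'} := by
  simp only [Admissible, not_forall, not_le] at hadm
  obtain ⟨q, hq, hIq⟩ := hadm
  set V := Submodule.span F {z | ∃ I' ⊆ Finset.range (2 * r), z = pfS y I' ∧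
      I'.card = I.card ∧ halfSum I < halfSum I'} with hV
  set Γ₀ := (Finset.range q).filter fun p => 2 * p ∈ I ∧ 2 * p + 1 ∈ I with hΓ₀
  set Z := (Finset.range q).filter fun p => 2 * p ∉ I ∧ 2 * p + 1 ∉ I with hZ
  have hcnt : cnt I (2 * q) + Z.card = q + Γ₀.card := cnt_two_mul I q
  have hg : Γ₀.card ≤ q := (Finset.card_filter_le _ _).trans (by simp)
  set K := (I.filter fun i => i / 2 ∉ Γ₀) with hK
  set H : Finset ℕ → A := fun Γ => pfL y (pairWord Γ ++ K.sort (· ≤ ·)) with hH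
  have hsum := sum_powersetCard_disjoint_eq_zero (F := F) (U := Finset.range r) (H := H)
    (by simpa using hF) (fun Γ _ => h.sum_pfL_insert _ Γ) ∅ Z (g := Γ₀.card) (by simp; lia)
    (by simp; lia)
  rw [← Finset.add_sum_erase _ _ (a := Γ₀)] at hsum
  swap
  · simp only [Finset.mem_filter, Finset.mem_powersetCard, Finset.empty_subset, true_and,
      and_true]
    refine ⟨fun p hp => ?_, ?_⟩
    · simp [hΓ₀] at hp ⊢
      lia
    · rw [Finset.disjoint_left]
      intro p hp hp'
      simp [hΓ₀] at hp
      simp [hZ] at hp'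
      tauto
  have hnd : ∀ Γ, (pairWord Γ ++ K.sort (· ≤ ·)).Nodup ↔ ∀ i ∈ K, i / 2 ∉ Γ := by
    intro Γ
    rw [List.nodup_append']
    simp only [nodup_pairWord, Finset.sort_nodup, true_and, List.disjoint_right, mem_pairWord,
      Finset.mem_sort]
  have hmem₀ : ∀ p ∈ Γ₀, 2 * p ∈ I ∧ 2 * p + 1 ∈ I ∧ p < q := by
    intro p hp
    simp [hΓ₀] at hp
    tauto
  have hhalf : ∀ Γ, (pairWord Γ ++ K.sort (· ≤ ·)).Nodup →
      halfSum (pairWord Γ ++ K.sort (· ≤ ·)).toFinset = 2 * ∑ p ∈ Γ, p + halfSum K := by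
    intro Γ hΓ
    rw [halfSum, List.sum_toFinset _ hΓ, List.map_append, List.sum_append, sum_pairWord]
    congr 1
    rw [← List.sum_toFinset _ (Finset.sort_nodup _ _), Finset.sort_toFinset]
    rfl
  have hcard : ∀ Γ, (pairWord Γ ++ K.sort (· ≤ ·)).Nodup →
      (pairWord Γ ++ K.sort (· ≤ ·)).toFinset.card = 2 * Γ.card + K.card := by
    intro Γ hΓ
    rw [List.toFinset_card_of_nodup hΓ, List.length_append, length_pairWord, Finset.length_sort]
  have hn₀ : (pairWord Γ₀ ++ K.sort (· ≤ ·)).Nodup := by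
    rw [hnd]
    intro i hi
    simp [hK] at hi
    exact hi.2
  have hf₀ : (pairWord Γ₀ ++ K.sort (· ≤ ·)).toFinset = I := by
    ext i
    simp only [List.toFinset_append, Finset.mem_union, List.mem_toFinset, mem_pairWord,
      Finset.mem_sort, hK, Finset.mem_filter]
    constructor
    · rintro (hi | hi)
      · have := hmem₀ _ hi
        rcases Nat.even_or_odd' i with ⟨k, rfl | rfl⟩
        · convert this.1 using 1; lia
        · convert this.2.1 using 1; lia
      · exact hi.1
    · tauto
  have hmem : H Γ₀ ∈ V := by
    rw [eq_neg_of_add_eq_zero_left hsum]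
    refine V.neg_mem (V.sum_mem fun Γ hΓ => ?_)
    simp only [Finset.mem_erase, Finset.mem_filter, Finset.mem_powersetCard, Finset.empty_subset,
      true_and] at hΓ
    obtain ⟨hne, ⟨hΓr, hΓc⟩, hΓZ⟩ := hΓ
    by_cases hn : (pairWord Γ ++ K.sort (· ≤ ·)).Nodup
    swap
    · rw [hH]
      simp only
      rw [pfL_eq_zero_of_not_nodup h.alt hn]
      exact V.zero_mem
    suffices pfS y (pairWord Γ ++ K.sort (· ≤ ·)).toFinset ∈ V by
      rcases pfL_eq_pfS h.alt hn with h' | h' <;> rw [hH] <;> simp only <;> rw [h']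
      · exact this
      · exact V.neg_mem this
    refine Submodule.subset_span ⟨_, ?_, rfl, ?_, ?_⟩
    · intro i hi
      simp only [List.toFinset_append, Finset.mem_union, List.mem_toFinset, mem_pairWord,
        Finset.mem_sort, hK, Finset.mem_filter] at hi
      rcases hi with hi | hi
      · have := hΓr hi
        simp at this ⊢
        lia
      · exact hI hi.1
    · rw [hcard _ hn, hΓc, ← hcard _ hn₀, hf₀]
    · rw [hhalf _ hn, ← hf₀, hhalf _ hn₀]
      have := sum_lt_sum_of_card_eq q hΓc.symm hne.symm (fun p hp _ => (hmem₀ p hp).2.2) ?_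
      · lia
      intro p hp hp'
      by_contra! hpq
      have hZp := Finset.disjoint_left.mp hΓZ hp
      rw [hnd] at hn
      have k1 : 2 * p ∉ I := by
        intro hpI
        refine hn (2 * p) ?_ (by simpa using hp)
        simp [hK, hpI, hp']
      have k2 : 2 * p + 1 ∉ I := by
        intro hpI
        have e : (2 * p + 1) / 2 = p := by lia
        refine hn (2 * p + 1) ?_ (by rwa [e])
        simp [hK, hpI, e, hp']
      exact hZp (by simp [hZ, k1, k2, hpq])
  have := pfL_eq_pfS h.alt hn₀
  rw [hf₀] at this
  rcases this with h' | h' <;> simp only [hH, h'] at hmem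
  · exact hmem
  · simpa using hmem

end SymplecticRelation

section Spanning

variable {F A : Type*} [Field F] [CommRing A] [Algebra F A] {r : ℕ} {y : ℕ → ℕ → A}

/-- The product of the Pfaffians of the rows of a tableau. -/
def tabProd (y : ℕ → ℕ → A) (T : Multiset (Finset ℕ)) : A := (T.map (pfS y)).prod

@[simp] lemma tabProd_cons (y : ℕ → ℕ → A) (I : Finset ℕ) (T : Multiset (Finset ℕ)) :
    tabProd y (I ::ₘ T) = pfS y I * tabProd y T := by simp [tabProd]

/-- `I` dominates `J` if, as columns read from the top, the entries of `I` are at most those of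
`J` and `I` is at least as long. -/
def Dominates (I J : Finset ℕ) : Prop := ∀ x, cnt J x ≤ cnt I x

/-- The tableaux whose products of Pfaffians form a basis. -/
structure GoodTab (r : ℕ) (T : Multiset (Finset ℕ)) : Prop where
  subset : ∀ I ∈ T, I ⊆ Finset.range (2 * r)
  nonempty : ∀ I ∈ T, I.Nonempty
  even : ∀ I ∈ T, Even I.card
  admissible : ∀ I ∈ T, Admissible r I
  chain : ∀ I ∈ T, ∀ J ∈ T, Dominates I J ∨ Dominates J I

/-- The measure which increases in the straightening procedure. -/
def tabKey (T : Multiset (Finset ℕ)) : ℕ ×ₗ ℕ ×ₗ ℤ ×ₗ ℕ :=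
  toLex ((T.map halfSum).sum, toLex ((T.map fun I => I.card ^ 2).sum,
    toLex (-(T.map fun I => ((I.card * ∑ i ∈ I, i : ℕ) : ℤ)).sum,
      (T.map fun I => (∑ i ∈ I, i) ^ 2).sum)))

/-- The span of the tableaux of the same size with larger measure. -/
def largerSpan (F : Type*) [Field F] [Algebra F A] (r : ℕ) (y : ℕ → ℕ → A)
    (T : Multiset (Finset ℕ)) : Submodule F A :=
  Submodule.span F {z | ∃ T' : Multiset (Finset ℕ), z = tabProd y T' ∧ T'.card = T.card ∧
    (∀ I ∈ T', I ⊆ Finset.range (2 * r)) ∧ tabKey T < tabKey T'}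

lemma mul_mem_of_mem_span {S : Set A} {V : Submodule F A} {z w : A} (hz : z ∈ Submodule.span F S)
    (h : ∀ s ∈ S, s * w ∈ V) : z * w ∈ V := by
  have : Submodule.span F S ≤ V.comap (LinearMap.mulRight F w) := Submodule.span_le.mpr h
  exact this hz

lemma mem_largerSpan_of_not_admissible (h : SympRel r y)
    (hF : ∀ k : ℕ, 1 ≤ k → k ≤ r → (k : F) ≠ 0) {I : Finset ℕ} {T : Multiset (Finset ℕ)}
    (hT : ∀ J ∈ I ::ₘ T, J ⊆ Finset.range (2 * r)) (hI : ¬Admissible r I) :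
    tabProd y (I ::ₘ T) ∈ largerSpan F r y (I ::ₘ T) := by
  rw [tabProd_cons]
  refine mul_mem_of_mem_span (h.pfS_mem hF (hT I (by simp)) hI) ?_
  rintro _ ⟨I', hI', rfl, hc, hlt⟩
  refine Submodule.subset_span ⟨I' ::ₘ T, by simp, by simp, ?_, ?_⟩
  · intro J hJ
    rcases Multiset.mem_cons.mp hJ with rfl | hJ
    · exact hI'
    · exact hT J (by simp [hJ])
  · rw [tabKey, tabKey, Prod.Lex.toLex_lt_toLex]
    left
    simpa using hlt

lemma mem_largerSpan_of_not_dominates (hy : IsAltPairing y) {I J : Finset ℕ}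
    {T : Multiset (Finset ℕ)} (hT : ∀ K ∈ I ::ₘ J ::ₘ T, K ⊆ Finset.range (2 * r))
    (hcard : J.card < I.card ∨ (J.card = I.card ∧ ∑ i ∈ I, i ≤ ∑ i ∈ J, i))
    (hIJ : ¬Dominates I J) :
    tabProd y (I ::ₘ J ::ₘ T) ∈ largerSpan F r y (I ::ₘ J ::ₘ T) := by
  simp only [Dominates, not_forall, not_le] at hIJ
  obtain ⟨x, hx⟩ := hIJ
  rw [tabProd_cons, tabProd_cons, ← mul_assoc]
  refine mul_mem_of_mem_span (pfS_mul_pfS_mem (F := F) hy I J (by lia) x hx) ?_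
  rintro _ ⟨I', J', rfl, hval, hcond⟩
  refine Submodule.subset_span ⟨I' ::ₘ J' ::ₘ T, by simp [mul_assoc], by simp, ?_, ?_⟩
  · have hsub : ∀ i, i ∈ I' ∨ i ∈ J' → i ∈ Finset.range (2 * r) := by
      intro i hi
      have : i ∈ I.val + J.val := by rw [← hval]; simpa using hi
      rcases Multiset.mem_add.mp this with h | h
      · exact hT I (by simp) h
      · exact hT J (by simp) h
    intro K hK
    simp only [Multiset.mem_cons] at hK
    rcases hK with rfl | rfl | hK
    · exact fun i hi => hsub i (Or.inl hi)
    · exact fun i hi => hsub i (Or.inr hi)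
    · exact hT K (by simp [hK])
  · have e0 : halfSum I' + halfSum J' = halfSum I + halfSum J := by
      have := congrArg (fun m => (Multiset.map (· / 2) m).sum) hval
      simp only [Multiset.map_add, Multiset.sum_add] at this
      exact this
    have e1 : I'.card + J'.card = I.card + J.card := by
      simpa using congrArg Multiset.card hval
    have e2 : ∑ i ∈ I', i + ∑ i ∈ J', i = ∑ i ∈ I, i + ∑ i ∈ J, i := by
      have := congrArg (fun m => (Multiset.map (fun i => i) m).sum) hval
      simp only [Multiset.map_add, Multiset.sum_add] at this
      exact this
    rw [tabKey, tabKey, Prod.Lex.toLex_lt_toLex]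
    right
    refine ⟨by simp only [Multiset.map_cons, Multiset.sum_cons]; lia, ?_⟩
    rw [Prod.Lex.toLex_lt_toLex, Prod.Lex.toLex_lt_toLex]
    simp only [Multiset.map_cons, Multiset.sum_cons]
    generalize ∑ i ∈ I', i = a' at *
    generalize ∑ i ∈ J', i = b' at *
    generalize ∑ i ∈ I, i = a at *
    generalize ∑ i ∈ J, i = b at *
    generalize I'.card = p' at *
    generalize J'.card = q' at *
    generalize I.card = p at *
    generalize J.card = q at *
    have hqp : q ≤ p := by lia
    rcases hcond with h | h | ⟨rfl, h⟩
    · left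
      suffices p ^ 2 + q ^ 2 < p' ^ 2 + q' ^ 2 by lia
      obtain ⟨d, rfl⟩ := Nat.exists_eq_add_of_lt h
      obtain rfl : q = q' + (d + 1) := by lia
      nlinarith
    · left
      suffices p ^ 2 + q ^ 2 < p' ^ 2 + q' ^ 2 by lia
      obtain ⟨d, rfl⟩ := Nat.exists_eq_add_of_lt h
      obtain rfl : q = p' + (d + 1) := by lia
      nlinarith
    · right
      obtain rfl : q' = q := by lia
      refine ⟨rfl, ?_⟩
      obtain ⟨d, rfl⟩ := Nat.exists_eq_add_of_lt h
      obtain rfl : b' = b + (d + 1) := by lia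
      rcases hcard with hc | ⟨rfl, hc⟩
      · left
        push_cast
        zify at hc
        nlinarith
      · right
        constructor
        · push_cast
          ring
        · nlinarith

lemma mem_largerSpan (h : SympRel r y) (hF : ∀ k : ℕ, 1 ≤ k → k ≤ r → (k : F) ≠ 0)
    {T : Multiset (Finset ℕ)} (hT : ∀ I ∈ T, I ⊆ Finset.range (2 * r))
    (hbad : ¬((∀ I ∈ T, Even I.card) ∧ (∀ I ∈ T, Admissible r I) ∧
      ∀ I ∈ T, ∀ J ∈ T, Dominates I J ∨ Dominates J I)) :
    tabProd y T ∈ largerSpan F r y T := by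
  by_cases h1 : ∀ I ∈ T, Even I.card
  swap
  · push Not at h1
    obtain ⟨I, hI, hodd⟩ := h1
    obtain ⟨T, rfl⟩ := Multiset.exists_cons_of_mem hI
    rw [tabProd_cons, pfS_eq_zero_of_odd _ (Nat.not_even_iff_odd.mp hodd), zero_mul]
    exact Submodule.zero_mem _
  by_cases h2 : ∀ I ∈ T, Admissible r I
  swap
  · push Not at h2
    obtain ⟨I, hI, hadm⟩ := h2
    obtain ⟨T, rfl⟩ := Multiset.exists_cons_of_mem hI
    exact mem_largerSpan_of_not_admissible h hF hT hadm
  have h3 : ¬∀ I ∈ T, ∀ J ∈ T, Dominates I J ∨ Dominates J I := fun h3 => hbad ⟨h1, h2, h3⟩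
  push Not at h3
  obtain ⟨I, hI, J, hJ, hIJ, hJI⟩ := h3
  obtain ⟨T, rfl⟩ := Multiset.exists_cons_of_mem hI
  rcases Multiset.mem_cons.mp hJ with rfl | hJ
  · exact absurd (fun _ => le_rfl) hIJ
  obtain ⟨T, rfl⟩ := Multiset.exists_cons_of_mem hJ
  have hd : (J.card < I.card ∨ (J.card = I.card ∧ ∑ i ∈ I, i ≤ ∑ i ∈ J, i)) ∨
      (I.card < J.card ∨ (I.card = J.card ∧ ∑ i ∈ J, i ≤ ∑ i ∈ I, i)) := by lia
  rcases hd with hd | hd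
  · exact mem_largerSpan_of_not_dominates h.alt hT hd hIJ
  · rw [Multiset.cons_swap] at hT ⊢
    exact mem_largerSpan_of_not_dominates h.alt hT hd hJI

lemma finite_setOf_tableaux (r n : ℕ) : {T : Multiset (Finset ℕ) | T.card = n ∧
    ∀ I ∈ T, I ⊆ Finset.range (2 * r)}.Finite := by
  refine (Set.finite_Icc 0 (n • (Finset.range (2 * r)).powerset.val)).subset ?_
  rintro T ⟨rfl, hT⟩
  refine ⟨Multiset.zero_le _, ?_⟩
  rw [Multiset.le_iff_count]
  intro I
  by_cases hI : I ∈ T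
  · rw [Multiset.count_nsmul, Multiset.count_eq_one_of_mem (Finset.nodup _)
      (Finset.mem_powerset.mpr (hT I hI)), mul_one]
    exact Multiset.count_le_card _ _
  · simp [Multiset.count_eq_zero_of_notMem hI]

lemma tabProd_mem_span_goodTab (h : SympRel r y) (hF : ∀ k : ℕ, 1 ≤ k → k ≤ r → (k : F) ≠ 0)
    {T : Multiset (Finset ℕ)} (hT : ∀ I ∈ T, I ⊆ Finset.range (2 * r)) :
    tabProd y T ∈ Submodule.span F {z | ∃ T', z = tabProd y T' ∧ GoodTab r T'} := by
  set V := Submodule.span F {z | ∃ T', z = tabProd y T' ∧ GoodTab r T'}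
  by_contra hTV
  have hfin : {T' : Multiset (Finset ℕ) | (T'.card = T.card ∧
      ∀ I ∈ T', I ⊆ Finset.range (2 * r)) ∧ tabProd y T' ∉ V}.Finite :=
    (finite_setOf_tableaux r T.card).subset fun T' hT' => hT'.1
  obtain ⟨S, ⟨⟨hSc, hS⟩, hSV⟩, hmax⟩ := Set.exists_max_image _ tabKey hfin ⟨T, ⟨rfl, hT⟩, hTV⟩
  apply hSV
  by_cases hbad : (∀ I ∈ S, Even I.card) ∧ (∀ I ∈ S, Admissible r I) ∧
      ∀ I ∈ S, ∀ J ∈ S, Dominates I J ∨ Dominates J I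
  · have e : tabProd y S = tabProd y (S.filter (·.Nonempty)) := by
      have : tabProd y (S.filter (¬ ·.Nonempty)) = 1 := by
        refine Multiset.prod_eq_one fun z hz => ?_
        simp only [Multiset.mem_map, Multiset.mem_filter, Finset.not_nonempty_iff_eq_empty] at hz
        obtain ⟨I, ⟨-, rfl⟩, rfl⟩ := hz
        simp
      rw [← mul_one (tabProd y (S.filter _)), ← this, tabProd, tabProd, tabProd,
        ← Multiset.prod_add, ← Multiset.map_add, Multiset.filter_add_not]
    rw [e]
    refine Submodule.subset_span ⟨_, rfl, ?_, ?_, ?_, ?_, ?_⟩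
    · exact fun I hI => hS I (Multiset.mem_of_mem_filter hI)
    · exact fun I hI => Multiset.of_mem_filter hI
    · exact fun I hI => hbad.1 I (Multiset.mem_of_mem_filter hI)
    · exact fun I hI => hbad.2.1 I (Multiset.mem_of_mem_filter hI)
    · exact fun I hI J hJ => hbad.2.2 I (Multiset.mem_of_mem_filter hI) J
        (Multiset.mem_of_mem_filter hJ)
  · refine (Submodule.span_le.mpr ?_ : largerSpan F r y S ≤ V) (mem_largerSpan h hF hS hbad)
    rintro _ ⟨S', rfl, hc, hS', hlt⟩
    by_contra hV
    exact (hmax S' ⟨⟨hc.trans hSc, hS'⟩, hV⟩).not_gt hlt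

/-- The products of Pfaffians of good tableaux span the algebra generated by the entries. -/
lemma span_goodTab_eq_top (h : SympRel r y) (hF : ∀ k : ℕ, 1 ≤ k → k ≤ r → (k : F) ≠ 0)
    (hgen : Algebra.adjoin F {z | ∃ i < 2 * r, ∃ j < 2 * r, z = y i j} = ⊤) :
    Submodule.span F {z | ∃ T', z = tabProd y T' ∧ GoodTab r T'} = ⊤ := by
  have h1 := Algebra.adjoin_eq_span F {z | ∃ i < 2 * r, ∃ j < 2 * r, z = y i j}
  rw [hgen, Algebra.top_toSubmodule] at h1
  rw [eq_top_iff, h1, Submodule.span_le]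
  intro z hz
  suffices ∃ (c : F) (T : Multiset (Finset ℕ)), z = c • tabProd y T ∧
      ∀ I ∈ T, I ⊆ Finset.range (2 * r) by
    obtain ⟨c, T, rfl, hT⟩ := this
    exact Submodule.smul_mem _ _ (tabProd_mem_span_goodTab h hF hT)
  induction hz using Submonoid.closure_induction with
  | one => exact ⟨1, 0, by simp [tabProd], by simp⟩
  | mul a b _ _ ha hb =>
    obtain ⟨c, T, rfl, hT⟩ := ha
    obtain ⟨c', T', rfl, hT'⟩ := hb
    refine ⟨c * c', T + T', by rw [smul_mul_smul_comm]; simp [tabProd], fun I hI => ?_⟩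
    rcases Multiset.mem_add.mp hI with h | h
    · exact hT I h
    · exact hT' I h
  | mem a ha =>
    obtain ⟨i, hi, j, hj, rfl⟩ := ha
    by_cases hij : i = j
    · exact ⟨0, 0, by simp [hij, h.alt.1], by simp⟩
    have h2 := pfL_eq_pfS h.alt (L := [i, j]) (by simp [hij])
    have h3 : pfL y [i, j] = y i j := by simp [pfL_cons]
    have h4 : ∀ I ∈ ({[i, j].toFinset} : Multiset (Finset ℕ)), I ⊆ Finset.range (2 * r) := by
      intro I hI
      rw [Multiset.mem_singleton] at hI
      subst hI
      intro a ha
      simp at ha ⊢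
      lia
    rw [h3] at h2
    rcases h2 with h2 | h2
    · exact ⟨1, {[i, j].toFinset}, by simp only [h2, tabProd]; simp, h4⟩
    · exact ⟨-1, {[i, j].toFinset}, by simp only [h2, tabProd]; simp, h4⟩

end Spanning

section LeadingExponent

open MvPolynomial

variable {F σ : Type*} [Field F] [LinearOrder σ]

/-- `e` is the leading exponent of `f` for the lexicographic order, the smallest variable of `σ`
being the most significant. -/
def IsLead (f : MvPolynomial σ F) (e : σ →₀ ℕ) : Prop :=
  f.coeff e ≠ 0 ∧ ∀ d, f.coeff d ≠ 0 → toLex d ≤ toLex e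

lemma IsLead.mul {f g : MvPolynomial σ F} {e e' : σ →₀ ℕ} (hf : IsLead f e) (hg : IsLead g e') :
    IsLead (f * g) (e + e') := by
  classical
  constructor
  · rw [coeff_mul, Finset.sum_eq_single (e, e')]
    · exact mul_ne_zero hf.1 hg.1
    · rintro ⟨d, d'⟩ hd hne
      rw [Finset.HasAntidiagonal.mem_antidiagonal] at hd
      by_contra h
      have h1 := hf.2 d (left_ne_zero_of_mul h)
      have h2 := hg.2 d' (right_ne_zero_of_mul h)
      apply hne
      have h3 : toLex d + toLex d' = toLex e + toLex e' := congrArg toLex hd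
      have h4 : toLex d = toLex e := by
        refine h1.eq_of_not_lt fun hlt => ?_
        exact (add_lt_add_of_lt_of_le hlt h2).ne h3
      have h5 : toLex d' = toLex e' := by
        rw [h4] at h3
        exact add_left_cancel h3
      exact Prod.ext h4 h5
    · intro h
      rw [Finset.HasAntidiagonal.mem_antidiagonal] at h
      exact absurd rfl h
  · intro d hd
    rw [coeff_mul] at hd
    obtain ⟨⟨a, b⟩, hab, h⟩ := Finset.exists_ne_zero_of_sum_ne_zero hd
    rw [Finset.HasAntidiagonal.mem_antidiagonal] at hab
    rw [← hab]
    exact add_le_add (hf.2 a (left_ne_zero_of_mul h)) (hg.2 b (right_ne_zero_of_mul h))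

lemma isLead_one : IsLead (1 : MvPolynomial σ F) 0 := by
  classical
  refine ⟨by simp, fun d hd => ?_⟩
  rw [coeff_one] at hd
  have : 0 = d := by by_contra h; simp [h] at hd
  rw [this]

lemma isLead_X (v : σ) : IsLead (X v : MvPolynomial σ F) (.single v 1) := by
  classical
  refine ⟨by simp, fun d hd => ?_⟩
  rw [coeff_X] at hd
  have : Finsupp.single v 1 = d := by by_contra h; simp [h] at hd
  rw [this]

lemma isLead_multiset_prod {κ : Type*} (s : Multiset κ) (f : κ → MvPolynomial σ F)
    (e : κ → σ →₀ ℕ) (h : ∀ i ∈ s, IsLead (f i) (e i)) :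
    IsLead (s.map f).prod (s.map e).sum := by
  induction s using Multiset.induction_on with
  | empty => simpa using isLead_one
  | cons a s ih =>
    rw [Multiset.map_cons, Multiset.prod_cons, Multiset.map_cons, Multiset.sum_cons]
    exact (h a (by simp)).mul (ih fun i hi => h i (by simp [hi]))

lemma IsLead.X_mul_add {f h : MvPolynomial σ F} {e : σ →₀ ℕ} {v : σ} (hf : IsLead f e)
    (hh : h ∈ supported F (Set.Ioi v)) : IsLead (X v * f + h) (.single v 1 + e) := by
  have key : ∀ d, h.coeff d ≠ 0 → toLex d < toLex (.single v 1 + e) := by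
    intro d hd
    have hz : ∀ w ≤ v, d w = 0 := by
      intro w hw
      rw [mem_supported] at hh
      by_contra hne
      have : w ∈ h.vars := (mem_vars_iff_mem_support w).mpr
        ⟨d, mem_support_iff.mpr hd, Finsupp.mem_support_iff.mpr hne⟩
      exact absurd (hh this) (not_lt.mpr hw)
    obtain ⟨w, hwm⟩ : ∃ w, IsLeast {w | (Finsupp.single v 1 + e : σ →₀ ℕ) w ≠ 0} w := by
      have hfin : {w | (Finsupp.single v 1 + e : σ →₀ ℕ) w ≠ 0}.Finite :=
        (Finsupp.single v 1 + e : σ →₀ ℕ).hasFiniteSupport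
      have hne : {w | (Finsupp.single v 1 + e : σ →₀ ℕ) w ≠ 0}.Nonempty := ⟨v, by simp⟩
      obtain ⟨w, hw⟩ := hfin.exists_minimal hne
      exact ⟨w, hw.1, fun x hx => (le_total w x).elim id fun h => hw.2 hx h⟩
    have hwv : w ≤ v := hwm.2 (by simp)
    refine ⟨w, fun x hx => ?_, ?_⟩
    · have : (Finsupp.single v 1 + e : σ →₀ ℕ) x = 0 := by
        by_contra hne
        exact absurd (hwm.2 hne) (not_le.mpr hx)
      exact (hz x (hx.le.trans hwv)).trans this.symm
    · change d w < (Finsupp.single v 1 + e : σ →₀ ℕ) w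
      rw [hz w hwv]
      exact Nat.pos_of_ne_zero hwm.1
  have hl := (isLead_X v).mul hf
  constructor
  · have : h.coeff (.single v 1 + e) = 0 := by
      by_contra hne
      exact (key _ hne).ne rfl
    rw [coeff_add, this, add_zero]
    exact hl.1
  · intro d hd
    by_cases h1 : h.coeff d = 0
    · rw [coeff_add, h1, add_zero] at hd
      exact hl.2 d hd
    · exact (key d h1).le

/-- Polynomials with distinct leading exponents are linearly independent. -/
lemma linearIndependent_of_isLead {κ : Type*} (f : κ → MvPolynomial σ F) (e : κ → σ →₀ ℕ)
    (h : ∀ i, IsLead (f i) (e i)) (he : Function.Injective e) : LinearIndependent F f := by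
  rw [linearIndependent_iff]
  intro c hc
  by_contra hne
  obtain ⟨i, hi, hmax⟩ := Finset.exists_max_image c.support (fun i => toLex (e i))
    (Finsupp.support_nonempty_iff.mpr hne)
  have h1 := congrArg (coeff (e i)) hc
  rw [Finsupp.linearCombination_apply, Finsupp.sum, coeff_sum, Finset.sum_eq_single i,
    coeff_smul, coeff_zero, smul_eq_mul] at h1
  · exact mul_ne_zero (Finsupp.mem_support_iff.mp hi) (h i).1 h1
  · intro j hj hji
    rw [coeff_smul, smul_eq_mul]
    by_contra h2
    have h3 := (h j).2 _ (right_ne_zero_of_mul h2)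
    exact hji (he (toLex.injective (le_antisymm (hmax j hj) h3)))
  · intro h'
    exact absurd hi h'

end LeadingExponent

section LeadingTableau

/-- The leading exponent of the Pfaffian with rows `l` of the generic isotropic matrix, where the
first `t` columns are already used. -/
def leadExp (r : ℕ) : ℕ → List ℕ → (ℕ ×ₗ ℕ →₀ ℕ)
  | t, [] => ∑ k ∈ Finset.range (t / 2), .single (toLex (2 * r, k)) 1
  | t, i :: l => (if i = 2 * t then 0 else .single (toLex (i, t)) 1) + leadExp r (t + 1) l

lemma leadExp_apply_last {r : ℕ} (t : ℕ) (l : List ℕ) (hl : ∀ i ∈ l, i < 2 * r) (k : ℕ) :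
    leadExp r t l (toLex (2 * r, k)) = if k < (t + l.length) / 2 then 1 else 0 := by
  induction l generalizing t with
  | nil =>
    rw [leadExp, Finsupp.finsetSum_apply]
    simp [Finsupp.single_apply]
  | cons i l ih =>
    have hi : i ≠ 2 * r := (hl i (by simp)).ne
    have e : t + (l.length + 1) = t + 1 + l.length := by ring
    rw [leadExp, Finsupp.add_apply, ih _ fun j hj => hl j (by simp [hj]), List.length_cons, e]
    split_ifs <;> simp [hi]

lemma leadExp_apply_of_lt {r t s : ℕ} (l : List ℕ) (hs : s < t) {i : ℕ} (hi : i < 2 * r) :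
    leadExp r t l (toLex (i, s)) = 0 := by
  induction l generalizing t with
  | nil =>
    rw [leadExp, Finsupp.finsetSum_apply]
    refine Finset.sum_eq_zero fun k _ => ?_
    simp [hi.ne']
  | cons j l ih =>
    rw [leadExp, Finsupp.add_apply, ih (hs.trans t.lt_succ_self)]
    split_ifs <;> simp [hs.ne']

lemma sum_leadExp_add {r : ℕ} (l : List ℕ) (hl : ∀ i ∈ l, i < 2 * r)
    (hp : l.Pairwise (· < ·)) {t s x : ℕ} (ht : t ≤ s) (hx : 2 * s < x) :
    ∑ i ∈ Finset.Ico x (2 * r), leadExp r t l (toLex (i, s)) +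
      (if s < t + (l.filter (· < x)).length then 1 else 0) =
      if s < t + l.length then 1 else 0 := by
  induction l generalizing t with
  | nil =>
    simp only [leadExp, List.filter_nil, List.length_nil, add_zero, ht.not_gt, if_false]
    refine Finset.sum_eq_zero fun i hi => ?_
    rw [Finsupp.finsetSum_apply]
    refine Finset.sum_eq_zero fun k _ => ?_
    simp [(Finset.mem_Ico.mp hi).2.ne']
  | cons j l ih =>
    have hj : j < 2 * r := hl j (by simp)
    rw [List.pairwise_cons] at hp
    have hfil : ¬ j < x → l.filter (· < x) = [] := fun h => by
      rw [List.filter_eq_nil_iff]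
      intro a ha
      have := hp.1 a ha
      simp; lia
    simp only [leadExp, Finsupp.add_apply, Finset.sum_add_distrib]
    rcases ht.eq_or_lt with rfl | hts
    · rw [Finset.sum_eq_zero (f := fun i => leadExp r (t + 1) l (toLex (i, t))) fun i hi =>
        leadExp_apply_of_lt l t.lt_succ_self (Finset.mem_Ico.mp hi).2]
      have h1 : ∑ i ∈ Finset.Ico x (2 * r),
          (if j = 2 * t then 0 else Finsupp.single (toLex (j, t)) 1 : ℕ ×ₗ ℕ →₀ ℕ) (toLex (i, t)) =
          if j < x then 0 else 1 := by
        by_cases hjx : j < x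
        · rw [if_pos hjx]
          refine Finset.sum_eq_zero fun i hi => ?_
          have := (Finset.mem_Ico.mp hi).1
          split_ifs
          · rfl
          · have : j ≠ i := by lia
            simp [this]
        · rw [if_neg hjx, if_neg (by lia), Finset.sum_eq_single j]
          · simp
          · intro i _ hi
            simp [hi.symm]
          · intro h
            exact absurd (Finset.mem_Ico.mpr ⟨not_lt.mp hjx, hj⟩) h
      rw [h1]
      by_cases hjx : j < x
      · simp [hjx]
      · simp [hjx, hfil hjx]
    · have h1 : ∑ i ∈ Finset.Ico x (2 * r),
          (if j = 2 * t then 0 else Finsupp.single (toLex (j, t)) 1 : ℕ ×ₗ ℕ →₀ ℕ)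
            (toLex (i, s)) = 0 := by
        refine Finset.sum_eq_zero fun i _ => ?_
        split_ifs
        · rfl
        · simp [hts.ne]
      rw [h1, zero_add]
      have e : ∀ m, t + (m + 1) = t + 1 + m := fun m => by ring
      have ih' := ih (fun i hi => hl i (by simp [hi])) hp.2 (t := t + 1) hts
      rw [List.length_cons, e l.length, ← ih']
      congr 1
      by_cases hjx : j < x
      · rw [List.filter_cons_of_pos (by simpa using hjx), List.length_cons, e]
      · simp [hjx, hfil hjx, hts.not_gt, hts]

/-- The leading exponent of the Pfaffian of the row `I`. -/
def rowExp (r : ℕ) (I : Finset ℕ) : ℕ ×ₗ ℕ →₀ ℕ := leadExp r 0 (I.sort (· ≤ ·))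

lemma sum_rowExp_add {r : ℕ} {I : Finset ℕ} (hI : I ⊆ Finset.range (2 * r)) (he : Even I.card)
    {s x : ℕ} (hx : 2 * s < x) :
    ∑ i ∈ Finset.Ico x (2 * r), rowExp r I (toLex (i, s)) + (if s < cnt I x then 1 else 0) =
      rowExp r I (toLex (2 * r, s / 2)) := by
  have hl : ∀ i ∈ I.sort (· ≤ ·), i < 2 * r := fun i hi =>
    Finset.mem_range.mp (hI ((Finset.mem_sort _).mp hi))
  have h1 := sum_leadExp_add (I.sort (· ≤ ·)) hl (Finset.sortedLT_sort I).pairwise s.zero_le hx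
  have h2 : ((I.sort (· ≤ ·)).filter (· < x)).length = cnt I x := by
    rw [cnt, Finset.card_def, Finset.filter_val, ← Multiset.coe_card, ← Multiset.filter_coe,
      Finset.sort_eq]
  rw [h2, Finset.length_sort, zero_add, zero_add] at h1
  rw [rowExp, leadExp_apply_last _ _ hl, h1, Finset.length_sort, zero_add]
  obtain ⟨m, hm⟩ := he
  refine if_congr ?_ rfl rfl
  lia

lemma Dominates.trans {I J K : Finset ℕ} (h : Dominates I J) (h' : Dominates J K) :
    Dominates I K := fun x => (h' x).trans (h x)

lemma cnt_injective {I J : Finset ℕ} (h : ∀ x, cnt I x = cnt J x) : I = J := by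
  have key : ∀ (I : Finset ℕ) x, cnt I (x + 1) = cnt I x + if x ∈ I then 1 else 0 := by
    intro I x
    rw [cnt, cnt, ← Finset.card_filter_add_card_filter_not (s := I.filter (· < x + 1)) (· < x),
      Finset.filter_filter, Finset.filter_filter]
    congr 2
    · ext; grind
    · split_ifs with hx
      · rw [Finset.card_eq_one]
        exact ⟨x, by ext; grind⟩
      · rw [Finset.card_eq_zero]
        ext; grind
  ext x
  have h1 := key I x
  have h2 := key J x
  rw [h, h, h2] at h1
  grind

lemma exists_dominates {T : Multiset (Finset ℕ)} (hne : T ≠ 0)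
    (hT : ∀ I ∈ T, ∀ J ∈ T, Dominates I J ∨ Dominates J I) :
    ∃ I ∈ T, ∀ J ∈ T, Dominates I J := by
  induction T using Multiset.induction_on with
  | empty => exact absurd rfl hne
  | cons a T ih =>
    have hrefl : Dominates a a := fun _ => le_rfl
    by_cases h0 : T = 0
    · subst h0
      exact ⟨a, by simp, by simpa using hrefl⟩
    · obtain ⟨I, hI, h⟩ := ih h0 fun I hI J hJ => hT I (by simp [hI]) J (by simp [hJ])
      rcases hT I (by simp [hI]) a (by simp) with h1 | h1
      · exact ⟨I, by simp [hI], by simpa [h1] using h⟩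
      · refine ⟨a, by simp, ?_⟩
        simpa [hrefl] using fun J hJ => h1.trans (h J hJ)

lemma eq_of_countP_cnt {T T' : Multiset (Finset ℕ)} (hn : ∀ I ∈ T, I.Nonempty)
    (hn' : ∀ I ∈ T', I.Nonempty) (hc : ∀ I ∈ T, ∀ J ∈ T, Dominates I J ∨ Dominates J I)
    (hc' : ∀ I ∈ T', ∀ J ∈ T', Dominates I J ∨ Dominates J I)
    (h : ∀ s x, T.countP (fun I => s < cnt I x) = T'.countP (fun I => s < cnt I x)) :
    T = T' := by
  induction hm : T.card using Nat.strong_induction_on generalizing T T' with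
  | _ m ih =>
    have h0 : ∀ s x, (∃ I ∈ T, s < cnt I x) ↔ ∃ I ∈ T', s < cnt I x := by
      intro s x
      rw [← Multiset.countP_pos, ← Multiset.countP_pos, h]
    have hex : ∀ I : Finset ℕ, I.Nonempty → ∃ x, 0 < cnt I x := by
      rintro I ⟨a, ha⟩
      exact ⟨a + 1, Finset.card_pos.mpr ⟨a, by simp [ha]⟩⟩
    by_cases hT : T = 0
    · subst hT
      by_contra hne
      obtain ⟨I, hI⟩ := Multiset.exists_mem_of_ne_zero (Ne.symm hne)
      obtain ⟨x, hx⟩ := hex I (hn' I hI)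
      simpa using (h0 0 x).mpr ⟨I, hI, hx⟩
    · obtain ⟨I, hI, hI1⟩ := exists_dominates hT hc
      obtain ⟨x, hx⟩ := hex I (hn I hI)
      obtain ⟨I₀, hI₀, -⟩ := (h0 0 x).mp ⟨I, hI, hx⟩
      have hT' : T' ≠ 0 := fun h => by simp [h] at hI₀
      obtain ⟨I', hI', hI1'⟩ := exists_dominates hT' hc'
      have hII : I = I' := by
        refine cnt_injective fun x => eq_of_forall_lt_iff fun s => ?_
        have e : s < cnt I x ↔ ∃ J ∈ T, s < cnt J x :=
          ⟨fun h => ⟨I, hI, h⟩, fun ⟨J, hJ, h⟩ => h.trans_le (hI1 J hJ x)⟩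
        have e' : s < cnt I' x ↔ ∃ J ∈ T', s < cnt J x :=
          ⟨fun h => ⟨I', hI', h⟩, fun ⟨J, hJ, h⟩ => h.trans_le (hI1' J hJ x)⟩
        rw [e, e', h0]
      subst hII
      obtain ⟨U, rfl⟩ := Multiset.exists_cons_of_mem hI
      obtain ⟨U', rfl⟩ := Multiset.exists_cons_of_mem hI'
      congr 1
      refine ih _ ?_ (fun J hJ => hn J (by simp [hJ])) (fun J hJ => hn' J (by simp [hJ]))
        (fun J hJ K hK => hc J (by simp [hJ]) K (by simp [hK]))
        (fun J hJ K hK => hc' J (by simp [hJ]) K (by simp [hK])) (fun s x => ?_) rfl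
      · rw [← hm, Multiset.card_cons]
        exact Nat.lt_succ_self _
      have := h s x
      rwa [Multiset.countP_cons, Multiset.countP_cons, Nat.add_right_cancel_iff] at this

lemma sum_map_rowExp_injective {r : ℕ} {T T' : Multiset (Finset ℕ)} (hT : GoodTab r T)
    (hT' : GoodTab r T') (h : (T.map (rowExp r)).sum = (T'.map (rowExp r)).sum) : T = T' := by
  have key : ∀ (T : Multiset (Finset ℕ)), (∀ I ∈ T, I ⊆ Finset.range (2 * r)) →
      (∀ I ∈ T, Even I.card) → ∀ s x, 2 * s < x →
      ∑ i ∈ Finset.Ico x (2 * r), (T.map (rowExp r)).sum (toLex (i, s)) +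
        T.countP (fun I => s < cnt I x) = (T.map (rowExp r)).sum (toLex (2 * r, s / 2)) := by
    intro T h1 h2 s x hx
    induction T using Multiset.induction_on with
    | empty => simp
    | cons I T ih =>
      rw [Multiset.map_cons, Multiset.sum_cons, Multiset.countP_cons, Finsupp.add_apply,
        ← ih (fun I hI => h1 I (by simp [hI])) (fun I hI => h2 I (by simp [hI])),
        ← sum_rowExp_add (h1 I (by simp)) (h2 I (by simp)) hx]
      simp only [Finsupp.add_apply, Finset.sum_add_distrib]
      ring
  refine eq_of_countP_cnt hT.nonempty hT'.nonempty hT.chain hT'.chain fun s x => ?_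
  by_cases hx : 2 * s < x
  · have h1 := key T hT.subset hT.even s x hx
    have h2 := key T' hT'.subset hT'.even s x hx
    rw [h] at h1
    exact Nat.add_left_cancel (h1.trans h2.symm)
  · have h0 : ∀ T, GoodTab r T → T.countP (fun I => s < cnt I x) = 0 := by
      intro T hT
      refine Multiset.countP_eq_zero.mpr fun I hI => not_lt.mpr ?_
      rcases le_or_gt s r with hs | hs
      · exact (Finset.card_le_card fun a ha => by grind).trans (hT.admissible I hI s hs)
      · refine (Finset.card_le_card fun a ha => ?_).trans
          ((hT.admissible I hI r le_rfl).trans hs.le)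
        have := hT.subset I hI (Finset.mem_filter.mp ha).1
        grind
    rw [h0 T hT, h0 T' hT']

end LeadingTableau

section GenericPoint

open MvPolynomial

variable (F : Type*) [Field F]

/-- The subalgebra of polynomials in the variables of the rows from `i` onwards. -/
abbrev rowsFrom (i : ℕ) : Subalgebra F (MvPolynomial (ℕ ×ₗ ℕ) F) :=
  supported F {v | i ≤ (ofLex v).1}

variable {F}

lemma rowsFrom_anti {i j : ℕ} (h : i ≤ j) : rowsFrom F j ≤ rowsFrom F i :=
  supported_mono fun _ hv => h.trans hv

lemma X_mem_rowsFrom {i j : ℕ} (t : ℕ) (h : i ≤ j) :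
    (X (toLex (j, t)) : MvPolynomial (ℕ ×ₗ ℕ) F) ∈ rowsFrom F i := by
  rw [rowsFrom, X_mem_supported]
  exact h

lemma rowsFrom_le_Ioi (i t : ℕ) :
    rowsFrom F (i + 1) ≤ supported F (Set.Ioi (toLex (i, t))) :=
  supported_mono fun _ hv => Prod.Lex.lt_iff.mpr (Or.inl hv)

variable (F) in
/-- A generic symmetric matrix. -/
def symEntry (s t : ℕ) : MvPolynomial (ℕ ×ₗ ℕ) F :=
  if t ≤ s then X (toLex (2 * s + 1, t)) else X (toLex (2 * t + 1, s))

lemma symEntry_comm (s t : ℕ) : symEntry F s t = symEntry F t s := by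
  unfold symEntry
  split_ifs with h1 h2
  · rw [le_antisymm h1 h2]
  all_goals first | rfl | lia

variable (F) in
/-- The odd rows of the generic isotropic frame. -/
def oddEntry (r s t : ℕ) : MvPolynomial (ℕ ×ₗ ℕ) F :=
  symEntry F s t -
    ∑ p : Finset.Ioo s r, X (toLex (2 * (p : ℕ), s)) * oddEntry r p t
termination_by r - s
decreasing_by
  have := Finset.mem_Ioo.mp p.2
  lia

lemma oddEntry_eq (r s t : ℕ) : oddEntry F r s t = symEntry F s t -
    ∑ p ∈ Finset.Ioo s r, X (toLex (2 * p, s)) * oddEntry F r p t := by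
  rw [oddEntry, ← Finset.sum_coe_sort (Finset.Ioo s r)]

variable (F) in
/-- The generic isotropic frame: the matrix of the rows of `r` vectors. -/
def frame (r i t : ℕ) : MvPolynomial (ℕ ×ₗ ℕ) F :=
  if i % 2 = 0 then if t < i / 2 then X (toLex (i, t)) else if t = i / 2 then 1 else 0
  else oddEntry F r (i / 2) t

lemma frame_even (r p t : ℕ) : frame F r (2 * p) t =
    if t < p then X (toLex (2 * p, t)) else if t = p then 1 else 0 := by
  simp [frame]

lemma frame_odd (r p t : ℕ) : frame F r (2 * p + 1) t = oddEntry F r p t := by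
  have : (2 * p + 1) / 2 = p := by lia
  simp [frame, this, Nat.add_mod]

lemma sum_frame_mul_frame {r s : ℕ} (t : ℕ) (hs : s < r) :
    ∑ p ∈ Finset.range r, frame F r (2 * p) s * frame F r (2 * p + 1) t = symEntry F s t := by
  have h1 : Finset.range r = Finset.range s ∪ insert s (Finset.Ioo s r) := by ext; grind
  have h2 : Disjoint (Finset.range s) (insert s (Finset.Ioo s r)) := by
    rw [Finset.disjoint_left]; grind
  rw [h1, Finset.sum_union h2, Finset.sum_insert (by simp), Finset.sum_eq_zero, zero_add]
  · simp only [frame_even, frame_odd, lt_irrefl, if_false, if_true, one_mul]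
    rw [oddEntry_eq, sub_add_eq_add_sub, sub_eq_iff_eq_add, add_right_inj]
    refine Finset.sum_congr rfl fun p hp => ?_
    rw [if_pos (Finset.mem_Ioo.mp hp).1]
  · intro p hp
    have := Finset.mem_range.mp hp
    rw [frame_even, if_neg (by lia), if_neg (by lia), zero_mul]

lemma symEntry_mem (s t : ℕ) : symEntry F s t ∈ rowsFrom F (2 * s + 1) := by
  unfold symEntry
  split_ifs with h
  · exact X_mem_rowsFrom _ le_rfl
  · exact X_mem_rowsFrom _ (by lia)

lemma oddEntry_mem (r s t : ℕ) : oddEntry F r s t ∈ rowsFrom F (2 * s + 1) := by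
  induction hm : r - s using Nat.strong_induction_on generalizing s with
  | _ m ih =>
    rw [oddEntry_eq]
    refine sub_mem (symEntry_mem s t) (sum_mem fun p hp => ?_)
    rw [Finset.mem_Ioo] at hp
    exact mul_mem (X_mem_rowsFrom _ (by lia))
      (rowsFrom_anti (by lia) (ih _ (by lia) p rfl))

lemma oddEntry_sub_mem (r s t : ℕ) :
    oddEntry F r s t - symEntry F s t ∈ rowsFrom F (2 * s + 2) := by
  rw [oddEntry_eq, sub_sub_cancel_left]
  refine neg_mem (sum_mem fun p hp => ?_)
  rw [Finset.mem_Ioo] at hp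
  exact mul_mem (X_mem_rowsFrom _ (by lia)) (rowsFrom_anti (by lia) (oddEntry_mem r p t))

lemma even_odd_cases (i : ℕ) : (∃ p, i = 2 * p) ∨ ∃ p, i = 2 * p + 1 := by
  rcases Nat.even_or_odd i with ⟨p, h⟩ | ⟨p, h⟩
  · exact Or.inl ⟨p, by lia⟩
  · exact Or.inr ⟨p, h⟩

lemma frame_mem (r i t : ℕ) : frame F r i t ∈ rowsFrom F i := by
  obtain ⟨p, rfl⟩ | ⟨p, rfl⟩ := even_odd_cases i
  · rw [frame_even]
    split_ifs
    · exact X_mem_rowsFrom _ le_rfl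
    · exact one_mem _
    · exact zero_mem _
  · rw [frame_odd]
    exact oddEntry_mem r p t

lemma frame_sub_mem (r : ℕ) {i t : ℕ} (h : 2 * t ≤ i) (h' : i ≠ 2 * t) :
    frame F r i t - X (toLex (i, t)) ∈ rowsFrom F (i + 1) := by
  obtain ⟨p, rfl⟩ | ⟨p, rfl⟩ := even_odd_cases i
  · rw [frame_even, if_pos (by lia), sub_self]
    exact zero_mem _
  · have := oddEntry_sub_mem (F := F) r p t
    rwa [symEntry, if_pos (by lia), ← frame_odd] at this

lemma frame_mem_Ioi (r : ℕ) {i s t : ℕ} (h : t < s) :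
    frame F r i s ∈ supported F (Set.Ioi (toLex (i, t))) := by
  have hX : (X (toLex (i, s)) : MvPolynomial (ℕ ×ₗ ℕ) F) ∈
      supported F (Set.Ioi (toLex (i, t))) := by
    rw [X_mem_supported]
    exact Prod.Lex.lt_iff.mpr (Or.inr ⟨rfl, h⟩)
  obtain ⟨p, rfl⟩ | ⟨p, rfl⟩ := even_odd_cases i
  · rw [frame_even]
    split_ifs
    · exact hX
    · exact one_mem _
    · exact zero_mem _
  · by_cases hs : s ≤ p
    · rw [← sub_add_cancel (frame F r (2 * p + 1) s) (X (toLex (2 * p + 1, s)))]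
      exact add_mem (rowsFrom_le_Ioi _ _ (frame_sub_mem r (by lia) (by lia))) hX
    · have h1 := oddEntry_sub_mem (F := F) r p s
      rw [frame_odd, ← sub_add_cancel (oddEntry F r p s) (symEntry F p s)]
      refine rowsFrom_le_Ioi _ _ (add_mem h1 ?_)
      rw [symEntry, if_neg hs]
      exact X_mem_rowsFrom _ (by lia)

variable (F) in
/-- The generic alternating form in normal form. -/
def blockPairing (r a b : ℕ) : MvPolynomial (ℕ ×ₗ ℕ) F :=
  if a % 2 = 0 ∧ b = a + 1 then X (toLex (2 * r, a / 2))
  else if b % 2 = 0 ∧ a = b + 1 then -X (toLex (2 * r, b / 2)) else 0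

lemma isAltPairing_blockPairing (r : ℕ) : IsAltPairing (blockPairing F r) := by
  constructor
  · intro a
    simp [blockPairing]
  · intro a b
    unfold blockPairing
    split_ifs <;> first | lia | simp

lemma blockPairing_mem {r i : ℕ} (h : i ≤ 2 * r) (a b : ℕ) :
    blockPairing F r a b ∈ rowsFrom F i := by
  unfold blockPairing
  split_ifs
  · exact X_mem_rowsFrom _ h
  · exact neg_mem (X_mem_rowsFrom _ h)
  · exact zero_mem _

lemma pfL_blockPairing_range' (r k m : ℕ) : pfL (blockPairing F r) (List.range' (2 * k) (2 * m)) =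
    ∏ j ∈ Finset.range m, X (toLex (2 * r, k + j)) := by
  induction m generalizing k with
  | zero => simp
  | succ m ih =>
    rw [show 2 * (m + 1) = 2 * m + 1 + 1 by ring, List.range'_succ, pfL_cons]
    rw [Finset.sum_eq_single ⟨0, by simp⟩]
    · have h := ih (k + 1)
      rw [mul_add, mul_one] at h
      simp [List.range'_succ, Finset.prod_range_succ', blockPairing, h, mul_comm (Finset.prod _ _),
        add_assoc, add_comm 1]
    · intro i _ hi
      have h0 : (i : ℕ) ≠ 0 := fun h => hi (Fin.ext h)
      rw [List.get_eq_getElem, List.getElem_range', blockPairing, if_neg (by lia),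
        if_neg (by lia)]
      simp
    · simp

lemma pairForm_mem {R A X : Type*} [CommRing R] [CommRing A] [Algebra R A] {S : Subalgebra R A}
    {y : X → X → A} (hy : ∀ a b, y a b ∈ S) {m m' : X →₀ A} (hm : ∀ a, m a ∈ S)
    (hm' : ∀ a, m' a ∈ S) : pairForm y m m' ∈ S := by
  rw [pairForm, Finsupp.linearCombination_apply, Finsupp.sum, LinearMap.sum_apply]
  refine sum_mem fun a _ => ?_
  rw [LinearMap.smul_apply, Finsupp.linearCombination_apply, Finsupp.sum, smul_eq_mul]
  exact mul_mem (hm a) (sum_mem fun b _ => mul_mem (hm' b) (hy a b))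

lemma pfL_mem {R A X : Type*} [CommRing R] [CommRing A] [Algebra R A] {S : Subalgebra R A}
    {y : X → X → A} {L : List X} (hy : ∀ a ∈ L, ∀ b ∈ L, y a b ∈ S) : pfL y L ∈ S := by
  induction hn : L.length using Nat.strong_induction_on generalizing L with
  | _ n ih =>
    cases L with
    | nil => simp
    | cons a l =>
      rw [pfL_cons]
      refine sum_mem fun i _ => mul_mem (mul_mem (pow_mem (neg_mem (one_mem _)) _)
        (hy _ (by simp) _ (by simp))) (ih _ ?_ (fun b hb c hc => ?_) rfl)
      · rw [List.length_eraseIdx_of_lt i.2, ← hn, List.length_cons]; lia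
      · exact hy _ (List.mem_cons_of_mem _ (List.mem_of_mem_eraseIdx hb)) _
          (List.mem_cons_of_mem _ (List.mem_of_mem_eraseIdx hc))

variable (F) in
/-- The row `i` of the generic isotropic frame, as a vector. -/
def frameVec (r i : ℕ) : ℕ →₀ MvPolynomial (ℕ ×ₗ ℕ) F :=
  ∑ s ∈ Finset.range r, .single s (frame F r i s)

variable (F) in
/-- The pairing of the rows of the generic isotropic frame. -/
def genPairing (r i j : ℕ) : MvPolynomial (ℕ ×ₗ ℕ) F :=
  pairForm (blockPairing F r) (frameVec F r i) (frameVec F r j)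

lemma genPairing_eq_sum (r i j : ℕ) : genPairing F r i j = ∑ s ∈ Finset.range r,
    ∑ t ∈ Finset.range r, frame F r i s * frame F r j t * blockPairing F r s t := by
  simp only [genPairing, frameVec, pairForm, map_sum, LinearMap.sum_apply,
    Finsupp.linearCombination_single, LinearMap.smul_apply, smul_eq_mul]
  rw [Finset.sum_comm]
  exact Finset.sum_congr rfl fun s _ => Finset.sum_congr rfl fun t _ => by ring

lemma sympRel_genPairing (r : ℕ) : SympRel r (genPairing F r) where
  alt := by
    have h := pairForm_isAlt (isAltPairing_blockPairing (F := F) r)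
    exact ⟨fun a => h _, fun a b => (LinearMap.IsAlt.neg h _ _).symm⟩
  isotropic a b := by
    have key : ∀ m m' : ℕ → MvPolynomial (ℕ ×ₗ ℕ) F, ∑ p ∈ Finset.range r,
        ((∑ s ∈ Finset.range r, m s * frame F r (2 * p) s) *
          (∑ t ∈ Finset.range r, m' t * frame F r (2 * p + 1) t) -
        (∑ s ∈ Finset.range r, m s * frame F r (2 * p + 1) s) *
          (∑ t ∈ Finset.range r, m' t * frame F r (2 * p) t)) = 0 := by
      intro m m'
      have h1 : ∀ p, (∑ s ∈ Finset.range r, m s * frame F r (2 * p) s) *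
          (∑ t ∈ Finset.range r, m' t * frame F r (2 * p + 1) t) -
        (∑ s ∈ Finset.range r, m s * frame F r (2 * p + 1) s) *
          (∑ t ∈ Finset.range r, m' t * frame F r (2 * p) t) =
          ∑ s ∈ Finset.range r, ∑ t ∈ Finset.range r, m s * m' t *
            (frame F r (2 * p) s * frame F r (2 * p + 1) t -
              frame F r (2 * p) t * frame F r (2 * p + 1) s) := by
        intro p
        rw [Finset.sum_mul_sum, Finset.sum_mul_sum, ← Finset.sum_sub_distrib]
        refine Finset.sum_congr rfl fun s _ => ?_
        rw [← Finset.sum_sub_distrib]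
        exact Finset.sum_congr rfl fun t _ => by ring
      rw [Finset.sum_congr rfl fun p _ => h1 p, Finset.sum_comm]
      refine Finset.sum_eq_zero fun s hs => ?_
      rw [Finset.sum_comm]
      refine Finset.sum_eq_zero fun t ht => ?_
      rw [← Finset.mul_sum, Finset.sum_sub_distrib,
        sum_frame_mul_frame t (Finset.mem_range.mp hs),
        sum_frame_mul_frame s (Finset.mem_range.mp ht), symEntry_comm, sub_self, mul_zero]
    have e1 : ∀ j, genPairing F r a j = ∑ t ∈ Finset.range r,
        (∑ s ∈ Finset.range r, frame F r a s * blockPairing F r s t) * frame F r j t := by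
      intro j
      rw [genPairing_eq_sum, Finset.sum_comm]
      refine Finset.sum_congr rfl fun t _ => ?_
      rw [Finset.sum_mul]
      exact Finset.sum_congr rfl fun s _ => by ring
    have e2 : ∀ i, genPairing F r i b = ∑ s ∈ Finset.range r,
        (∑ t ∈ Finset.range r, frame F r b t * blockPairing F r s t) * frame F r i s := by
      intro i
      rw [genPairing_eq_sum]
      refine Finset.sum_congr rfl fun t _ => ?_
      rw [Finset.sum_mul]
      exact Finset.sum_congr rfl fun s _ => by ring
    simp only [e1, e2]
    exact key _ _
  trace := by
    simp only [genPairing_eq_sum]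
    rw [Finset.sum_comm]
    have h1 : ∀ s ∈ Finset.range r, ∑ p ∈ Finset.range r, ∑ t ∈ Finset.range r,
        frame F r (2 * p) s * frame F r (2 * p + 1) t * blockPairing F r s t =
        ∑ t ∈ Finset.range r, symEntry F s t * blockPairing F r s t := by
      intro s hs
      rw [Finset.sum_comm]
      refine Finset.sum_congr rfl fun t _ => ?_
      rw [← Finset.sum_mul, sum_frame_mul_frame t (Finset.mem_range.mp hs)]
    rw [Finset.sum_congr rfl h1]
    rw [← Finset.sum_product']
    have hK := isAltPairing_blockPairing (F := F) r
    refine Finset.sum_involution (fun a _ => a.swap) ?_ ?_ ?_ ?_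
    · rintro ⟨s, t⟩ _
      rw [Prod.swap, hK.2 s t, symEntry_comm s t]
      ring
    · rintro ⟨s, t⟩ _ h h'
      obtain rfl : t = s := congrArg Prod.fst h'
      exact h (by rw [hK.1, mul_zero])
    · rintro ⟨s, t⟩ h
      rw [Finset.mem_product] at h ⊢
      exact h.symm
    · rintro ⟨s, t⟩ _
      rfl

end GenericPoint

section GenericIndependence

open MvPolynomial

variable {F : Type*} [Field F]

variable (F) in
/-- The basis vectors and the rows of the generic isotropic frame. -/
def extVec (r : ℕ) : ℕ ⊕ ℕ → (ℕ →₀ MvPolynomial (ℕ ×ₗ ℕ) F) :=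
  Sum.elim (fun s => .single s 1) (frameVec F r)

variable (F) in
/-- The Pfaffian of the first `t` basis vectors and of the rows `l` of the generic frame. -/
def partialPf (r t : ℕ) (l : List ℕ) : MvPolynomial (ℕ ×ₗ ℕ) F :=
  pfW (pairForm (blockPairing F r)) (pairForm_isAlt (isAltPairing_blockPairing r))
    (wedge (extVec F r) ((List.range t).map .inl ++ l.map .inr))

lemma pfL_genPairing (r : ℕ) (l : List ℕ) : pfL (genPairing F r) l = partialPf F r 0 l := by
  rw [partialPf, pfW_wedge, List.range_zero, List.map_nil, List.nil_append, pfL_map]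
  rfl

lemma frameVec_apply_mem {r i : ℕ} (a : ℕ) : frameVec F r i a ∈ rowsFrom F i := by
  rw [frameVec, Finsupp.finsetSum_apply]
  refine sum_mem fun s _ => ?_
  rw [Finsupp.single_apply]
  split_ifs
  · exact frame_mem r i s
  · exact zero_mem _

lemma pfW_extVec_mem {r i : ℕ} (hi : i ≤ 2 * r) (L : List ℕ) {l : List ℕ} (hl : ∀ j ∈ l, i ≤ j) :
    pfW (pairForm (blockPairing F r)) (pairForm_isAlt (isAltPairing_blockPairing r))
      (wedge (extVec F r) (L.map .inl ++ l.map .inr)) ∈ rowsFrom F i := by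
  have hv : ∀ x ∈ (L.map .inl ++ l.map .inr : List (ℕ ⊕ ℕ)), ∀ a,
      extVec F r x a ∈ rowsFrom F i := by
    rintro (s | j) hx a
    · rw [extVec, Sum.elim_inl, Finsupp.single_apply]
      split_ifs
      · exact one_mem _
      · exact zero_mem _
    · exact rowsFrom_anti (hl j (by simpa using hx)) (frameVec_apply_mem a)
  rw [pfW_wedge]
  exact pfL_mem fun a ha b hb => pairForm_mem (blockPairing_mem hi) (hv a ha) (hv b hb)

lemma partialPf_nil {r t : ℕ} (ht : Even t) :
    partialPf F r t [] = ∏ k ∈ Finset.range (t / 2), X (toLex (2 * r, k)) := by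
  obtain ⟨m, rfl⟩ := ht
  rw [partialPf, pfW_wedge, List.map_nil, List.append_nil, pfL_map]
  have := pfL_blockPairing_range' (F := F) r 0 m
  rw [mul_zero, ← List.range_eq_range', two_mul] at this
  simp only [extVec, Sum.elim_inl, pairForm_single]
  rw [this, ← two_mul, Nat.mul_div_cancel_left _ two_pos]
  simp

lemma partialPf_cons {r t : ℕ} (ht : t < r) (i : ℕ) (l : List ℕ) :
    partialPf F r t (i :: l) = frame F r i t * partialPf F r (t + 1) l +
      ∑ s ∈ Finset.Ioo t r, frame F r i s *
        pfW (pairForm (blockPairing F r)) (pairForm_isAlt (isAltPairing_blockPairing r))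
          (wedge (extVec F r) ((List.range t ++ [s]).map .inl ++ l.map .inr)) := by
  set P := pfW (pairForm (blockPairing F r)) (pairForm_isAlt (isAltPairing_blockPairing r))
  have h1 : partialPf F r t (i :: l) = ∑ s ∈ Finset.range r, frame F r i s *
      P (wedge (extVec F r) ((List.range t ++ [s]).map .inl ++ l.map .inr)) := by
    rw [partialPf, wedge_append, List.map_cons, wedge_cons]
    have : extVec F r (.inr i) = ∑ s ∈ Finset.range r, frame F r i s • extVec F r (.inl s) := by
      simp [extVec, frameVec]
    rw [this, map_sum, Finset.sum_mul, Finset.mul_sum, map_sum]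
    refine Finset.sum_congr rfl fun s _ => ?_
    rw [map_smul, smul_mul_assoc, mul_smul_comm, map_smul, smul_eq_mul, List.map_append,
      List.append_assoc, wedge_append, List.map_singleton, List.singleton_append, wedge_cons]
  have h2 : Finset.range r = Finset.range t ∪ insert t (Finset.Ioo t r) := by ext; grind
  have h3 : Disjoint (Finset.range t) (insert t (Finset.Ioo t r)) := by
    rw [Finset.disjoint_left]; grind
  rw [h1, h2, Finset.sum_union h3, Finset.sum_insert (by simp), Finset.sum_eq_zero, zero_add,
    partialPf, List.range_succ]
  intro s hs
  rw [wedge_eq_zero, map_zero, mul_zero]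
  intro h
  have h4 := (List.nodup_append.mp h).1
  rw [List.map_append] at h4
  exact (List.nodup_append.mp h4).2.2 (.inl s) (by simpa using hs) (.inl s) (by simp) rfl

lemma isLead_partialPf {r t : ℕ} (l : List ℕ) (hl : ∀ i ∈ l, i < 2 * r)
    (hp : l.Pairwise (· < ·)) (ha : ∀ k (hk : k < l.length), 2 * (t + k) ≤ l[k])
    (he : Even (t + l.length)) : IsLead (partialPf F r t l) (leadExp r t l) := by
  induction l generalizing t with
  | nil =>
    rw [partialPf_nil (by simpa using he), leadExp]
    exact isLead_multiset_prod _ _ _ fun k _ => isLead_X _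
  | cons i l ih =>
    have hi : i < 2 * r := hl i (by simp)
    have hti : 2 * t ≤ i := ha 0 (by simp)
    rw [List.pairwise_cons] at hp
    have e1 : ∀ k, t + 1 + k = t + (k + 1) := fun k => by ring
    have ih' := ih (t := t + 1) (fun j hj => hl j (by simp [hj])) hp.2
      (fun k hk => by rw [e1]; exact ha (k + 1) (by simpa using hk))
      (by rw [e1]; exact he)
    rw [partialPf_cons (by lia), leadExp]
    split_ifs with h
    · rw [zero_add, Finset.sum_eq_zero, add_zero, h, frame_even]
      · simpa using ih'
      · intro s hs
        have := (Finset.mem_Ioo.mp hs).1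
        rw [h, frame_even, if_neg (by lia), if_neg (by lia), zero_mul]
    · have e : frame F r i t = X (toLex (i, t)) + (frame F r i t - X (toLex (i, t))) := by ring
      rw [e, add_mul, add_assoc]
      refine ih'.X_mul_add (add_mem (rowsFrom_le_Ioi i t (mul_mem (frame_sub_mem r hti h) ?_))
        (sum_mem fun s hs => mul_mem (frame_mem_Ioi r (Finset.mem_Ioo.mp hs).1)
          (rowsFrom_le_Ioi i t ?_)))
      all_goals exact pfW_extVec_mem (by lia) _ hp.1

lemma isLead_pfS_genPairing {r : ℕ} {I : Finset ℕ} (hI : I ⊆ Finset.range (2 * r))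
    (he : Even I.card) (ha : Admissible r I) : IsLead (pfS (genPairing F r) I) (rowExp r I) := by
  rw [pfS, pfL_genPairing, rowExp]
  refine isLead_partialPf _ (fun i hi => Finset.mem_range.mp (hI ((Finset.mem_sort _).mp hi)))
    (Finset.sortedLT_sort I).pairwise (fun k hk => ?_) (by simpa using he)
  rw [zero_add]
  by_contra! hlt
  have hmono := Finset.sortedLT_sort I
  have hcnt : ∀ q, (I.sort (· ≤ ·))[k] < 2 * q → k + 1 ≤ cnt I (2 * q) := by
    intro q hq
    have : (Finset.univ.image fun j : Fin (k + 1) =>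
        (I.sort (· ≤ ·))[(j : ℕ)]'(lt_of_le_of_lt (Nat.lt_succ_iff.mp j.2) hk)) ⊆
        I.filter (· < 2 * q) := by
      intro a ha
      obtain ⟨j, -, rfl⟩ := Finset.mem_image.mp ha
      rw [Finset.mem_filter]
      refine ⟨(Finset.mem_sort (· ≤ ·)).mp (List.getElem_mem _), lt_of_le_of_lt ?_ hq⟩
      exact hmono.strictMono_get.monotone (a := ⟨j, _⟩) (b := ⟨k, hk⟩) (Nat.lt_succ_iff.mp j.2)
    refine le_trans ?_ (Finset.card_le_card this)
    rw [Finset.card_image_of_injective, Finset.card_fin]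
    intro a b hab
    have := hmono.nodup.getElem_inj_iff.mp hab
    exact Fin.ext this
  rcases le_or_gt k r with hkr | hkr
  · exact absurd (hcnt k hlt) (not_le.mpr (Nat.lt_succ_iff.mpr (ha k hkr)))
  · have h1 : (I.sort (· ≤ ·))[k] < 2 * r :=
      Finset.mem_range.mp (hI ((Finset.mem_sort _).mp (List.getElem_mem hk)))
    have := hcnt r h1
    have := ha r le_rfl
    lia

lemma linearIndependent_tabProd_genPairing (r : ℕ) :
    LinearIndependent F fun T : {T // GoodTab r T} => tabProd (genPairing F r) T.1 := by
  refine linearIndependent_of_isLead _ (fun T => (T.1.map (rowExp r)).sum) (fun T => ?_)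
    fun T T' h => Subtype.ext (sum_map_rowExp_injective T.2 T'.2 h)
  exact isLead_multiset_prod _ _ _ fun I hI =>
    isLead_pfS_genPairing (T.2.subset I hI) (T.2.even I hI) (T.2.admissible I hI)

end GenericIndependence

section CoordinateRing

open MvPolynomial

variable {C : Type*} [CommRing C] {r : ℕ}

@[simp] lemma ordIdx_emb (p : Fin r) : ordIdx r (emb r p) = 2 * p + 1 := by simp [ordIdx, emb]

@[simp] lemma ordIdx_embBar (p : Fin r) : ordIdx r (embBar r p) = 2 * p := by
  simp [ordIdx, embBar]

lemma ordIdx_injective (r : ℕ) : Function.Injective (ordIdx r) := by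
  intro a b h
  unfold ordIdx at h
  ext
  split_ifs at h <;> lia

lemma exists_ordIdx {i : ℕ} (hi : i < 2 * r) : ∃ a, ordIdx r a = i := by
  obtain ⟨p, rfl⟩ | ⟨p, rfl⟩ := even_odd_cases i
  · exact ⟨embBar r ⟨p, by lia⟩, by simp⟩
  · exact ⟨emb r ⟨p, by lia⟩, by simp⟩

lemma sum_emb_add_embBar {M : Type*} [AddCommMonoid M] (f : Fin (2 * r) → M) :
    ∑ x, f x = ∑ p, (f (emb r p) + f (embBar r p)) := by
  rw [Finset.sum_add_distrib, ← Fintype.sum_equiv (finSumFinEquiv.trans (finCongr (two_mul r).symm))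
    (fun x => f ((finSumFinEquiv.trans (finCongr (two_mul r).symm)) x)) f fun _ => rfl,
    Fintype.sum_sum_type]
  rfl

lemma Jmat_mul_emb (Y : Matrix (Fin (2 * r)) (Fin (2 * r)) C) (p : Fin r) (b : Fin (2 * r)) :
    (Jmat r C * Y) (emb r p) b = Y (embBar r p) b := by
  rw [Matrix.mul_apply, Finset.sum_eq_single (embBar r p)]
  · simp [Jmat, emb, embBar, add_comm]
  · intro j _ hj
    have h1 : (j : ℕ) ≠ p + r := fun h => hj (Fin.ext (by simp [embBar, h, add_comm]))
    have h2 : (p : ℕ) ≠ j + r := by lia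
    simp [Jmat, emb, h1, h2]
  · simp

lemma Jmat_mul_embBar (Y : Matrix (Fin (2 * r)) (Fin (2 * r)) C) (p : Fin r) (b : Fin (2 * r)) :
    (Jmat r C * Y) (embBar r p) b = -Y (emb r p) b := by
  rw [Matrix.mul_apply, Finset.sum_eq_single (emb r p)]
  · have h1 : (p : ℕ) ≠ p + r + r := by have := p.2; lia
    simp [Jmat, emb, embBar, add_comm (r : ℕ) p, h1]
  · intro j _ hj
    have h1 : (j : ℕ) ≠ r + p + r := by have := j.2; lia
    have h2 : r + p ≠ (j : ℕ) + r := fun h => hj (Fin.ext (by simp [emb]; lia))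
    simp [Jmat, embBar, h1, h2]
  · simp

lemma transpose_mul_Jmat_mul (Y : Matrix (Fin (2 * r)) (Fin (2 * r)) C) (a b : Fin (2 * r)) :
    (Yᵀ * Jmat r C * Y) a b = ∑ p : Fin r,
      (Y (emb r p) a * Y (embBar r p) b - Y (embBar r p) a * Y (emb r p) b) := by
  rw [Matrix.mul_assoc, Matrix.mul_apply, sum_emb_add_embBar]
  simp [Jmat_mul_emb, Jmat_mul_embBar, sub_eq_add_neg]

lemma trace_Jmat_mul (Y : Matrix (Fin (2 * r)) (Fin (2 * r)) C) :
    (Jmat r C * Y).trace =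
      ∑ p : Fin r, (Y (embBar r p) (emb r p) - Y (emb r p) (embBar r p)) := by
  rw [Matrix.trace, sum_emb_add_embBar]
  simp [Jmat_mul_emb, Jmat_mul_embBar, sub_eq_add_neg]

lemma VIdeal_le_ker_iff {R : Type*} [CommRing R] (f : PolyRing r R →+* C) :
    VIdeal r R ≤ RingHom.ker f ↔ MemV r ((Ygen r R).map f) := by
  have hJ : (Jmat r (PolyRing r R)).map f = Jmat r C := by
    ext i j
    simp only [Jmat, Matrix.map_apply, Matrix.of_apply]
    split_ifs <;> simp
  have h3 : ∀ i j, f (((Ygen r R)ᵀ * Jmat r (PolyRing r R) * Ygen r R) i j) =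
      (((Ygen r R).map f)ᵀ * Jmat r C * (Ygen r R).map f) i j := by
    intro i j
    rw [← hJ, ← Matrix.transpose_map, ← Matrix.map_mul, ← Matrix.map_mul, Matrix.map_apply]
  have h4 : ((-(Jmat r (PolyRing r R) * Ygen r R)).charpoly - Polynomial.X ^ (2 * r)).map f =
      (-(Jmat r C * (Ygen r R).map f)).charpoly - Polynomial.X ^ (2 * r) := by
    rw [Polynomial.map_sub, ← Matrix.charpoly_map, Polynomial.map_pow, Polynomial.map_X, ← hJ,
      ← Matrix.map_mul]
    congr 2
    ext i j
    rw [Matrix.map_apply, Matrix.neg_apply, Matrix.neg_apply, Matrix.map_apply, map_neg]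
  rw [VIdeal, Ideal.span_le]
  simp only [Set.union_subset_iff]
  simp only [Set.subset_def, Set.mem_ofPred_eq, SetLike.mem_coe, RingHom.mem_ker,
    forall_exists_index]
  constructor
  · rintro ⟨⟨⟨h1, h2⟩, h3'⟩, h4'⟩
    refine ⟨?_, fun i => h2 _ i rfl, ?_, ?_⟩
    · ext i j
      have := h1 _ i j rfl
      rw [Matrix.add_apply, map_add] at this
      exact eq_neg_of_add_eq_zero_left this
    · ext i j
      rw [← h3]
      exact h3' _ i j rfl
    · rw [← sub_eq_zero, ← h4]
      ext k
      rw [Polynomial.coeff_map]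
      exact h4' _ k rfl
  · rintro ⟨h1, h2, h3', h4'⟩
    refine ⟨⟨⟨?_, ?_⟩, ?_⟩, ?_⟩
    · rintro _ i j rfl
      rw [Matrix.add_apply, map_add]
      have := congrFun₂ h1 i j
      exact eq_neg_iff_add_eq_zero.mp this
    · rintro _ i rfl
      exact h2 i
    · rintro _ i j rfl
      rw [h3, h3']
      rfl
    · rintro _ k rfl
      rw [← Polynomial.coeff_map, h4, h4', sub_self, Polynomial.coeff_zero]

/-- The entries of a matrix, indexed by the positions of the indices in the order `≺`. -/
def ordPairing (Y : Matrix (Fin (2 * r)) (Fin (2 * r)) C) (i j : ℕ) : C :=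
  Function.extend (Prod.map (ordIdx r) (ordIdx r)) (fun p => Y p.1 p.2) 0 (i, j)

@[simp] lemma ordPairing_ordIdx (Y : Matrix (Fin (2 * r)) (Fin (2 * r)) C) (a b : Fin (2 * r)) :
    ordPairing Y (ordIdx r a) (ordIdx r b) = Y a b :=
  ((ordIdx_injective r).prodMap (ordIdx_injective r)).extend_apply _ _ (a, b)

lemma ordPairing_eq_zero (Y : Matrix (Fin (2 * r)) (Fin (2 * r)) C) {i j : ℕ}
    (h : (¬∃ a, ordIdx r a = i) ∨ ¬∃ a, ordIdx r a = j) : ordPairing Y i j = 0 := by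
  refine Function.extend_apply' _ _ _ ?_
  rintro ⟨⟨a, b⟩, hab⟩
  rw [Prod.map_apply, Prod.mk.injEq] at hab
  exact h.elim (fun h => h ⟨a, hab.1⟩) fun h => h ⟨b, hab.2⟩

lemma MemV.sympRel_ordPairing {Y : Matrix (Fin (2 * r)) (Fin (2 * r)) C} (h : MemV r Y)
    (h2 : 0 < r → IsUnit (2 : C)) : SympRel r (ordPairing Y) := by
  obtain ⟨hs, hd, hJ, hc⟩ := h
  have hs' : ∀ a b, Y a b = -Y b a := fun a b => congrFun₂ hs a b
  refine ⟨⟨fun i => ?_, fun i j => ?_⟩, fun i j => ?_, ?_⟩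
  · by_cases hi : ∃ a, ordIdx r a = i
    · obtain ⟨a, rfl⟩ := hi
      simp [hd]
    · exact ordPairing_eq_zero Y (Or.inl hi)
  · by_cases hi : ∃ a, ordIdx r a = i
    · by_cases hj : ∃ b, ordIdx r b = j
      · obtain ⟨a, rfl⟩ := hi
        obtain ⟨b, rfl⟩ := hj
        simpa using hs' a b
      · rw [ordPairing_eq_zero Y (Or.inr hj), ordPairing_eq_zero Y (Or.inl hj), neg_zero]
    · rw [ordPairing_eq_zero Y (Or.inl hi), ordPairing_eq_zero Y (Or.inr hi), neg_zero]
  · by_cases hi : ∃ a, ordIdx r a = i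
    · by_cases hj : ∃ b, ordIdx r b = j
      · obtain ⟨a, rfl⟩ := hi
        obtain ⟨b, rfl⟩ := hj
        have h1 := transpose_mul_Jmat_mul Y a b
        rw [hJ, Matrix.zero_apply] at h1
        rw [h1, Finset.sum_range]
        refine Finset.sum_congr rfl fun p _ => ?_
        rw [← ordIdx_emb, ← ordIdx_embBar]
        simp only [ordPairing_ordIdx, hs' a]
        ring
      · simp [ordPairing_eq_zero Y (Or.inr hj)]
    · simp [ordPairing_eq_zero Y (Or.inl hi)]
  · rcases Nat.eq_zero_or_pos r with rfl | hr
    · simp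
    · have : Nonempty (Fin (2 * r)) := ⟨⟨0, by lia⟩⟩
      have h1 := Matrix.trace_eq_neg_charpoly_coeff (-(Jmat r C * Y))
      rw [hc, Polynomial.coeff_X_pow, Fintype.card_fin, if_neg (by lia), neg_zero,
        Matrix.trace_neg, neg_eq_zero, trace_Jmat_mul] at h1
      rw [← (h2 hr).mul_right_eq_zero, ← h1, Finset.sum_range, Finset.mul_sum]
      refine Finset.sum_congr rfl fun p _ => ?_
      rw [← ordIdx_emb, ← ordIdx_embBar, ordPairing_ordIdx, hs' (emb r p)]
      ring

lemma SympRel.memV [IsDomain C] {y : ℕ → ℕ → C} (h : SympRel r y) :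
    MemV r (Matrix.of fun a b => y (ordIdx r a) (ordIdx r b)) := by
  set Y : Matrix (Fin (2 * r)) (Fin (2 * r)) C :=
    Matrix.of fun a b => y (ordIdx r a) (ordIdx r b)
  have hs : Y = -Yᵀ := by
    ext a b
    exact h.alt.2 _ _
  have hJ : Yᵀ * Jmat r C * Y = 0 := by
    ext a b
    rw [transpose_mul_Jmat_mul, Matrix.zero_apply, ← h.isotropic (ordIdx r a) (ordIdx r b),
      Finset.sum_range]
    refine Finset.sum_congr rfl fun p _ => ?_
    simp only [Y, Matrix.of_apply, ordIdx_emb, ordIdx_embBar, h.alt.2 (ordIdx r a)]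
    ring
  refine ⟨hs, fun a => h.alt.1 _, hJ, ?_⟩
  have hn : IsNilpotent (-(Jmat r C * Y)) := by
    refine ⟨2, ?_⟩
    have h1 : Y * Jmat r C * Y = 0 := by
      calc Y * Jmat r C * Y = -Yᵀ * Jmat r C * Y := by rw [← hs]
        _ = 0 := by rw [Matrix.neg_mul, Matrix.neg_mul, hJ, neg_zero]
    rw [neg_sq, sq, Matrix.mul_assoc, ← Matrix.mul_assoc Y, h1, Matrix.mul_zero]
  have h2 := (Matrix.isNilpotent_charpoly_sub_pow_of_isNilpotent hn).eq_zero
  rwa [Fintype.card_fin, sub_eq_zero] at h2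

variable {F : Type*} [Field F]

variable (r F) in
/-- The generic matrix over the coordinate ring. -/
def genMat : Matrix (Fin (2 * r)) (Fin (2 * r)) (FV r F) :=
  (Ygen r F).map (Ideal.Quotient.mk (VIdeal r F))

lemma memV_genMat : MemV r (genMat r F) :=
  (VIdeal_le_ker_iff (Ideal.Quotient.mk (VIdeal r F))).mp Ideal.mk_ker.ge

lemma adjoin_ordPairing_genMat : Algebra.adjoin F
    {z | ∃ i < 2 * r, ∃ j < 2 * r, z = ordPairing (genMat r F) i j} = ⊤ := by
  rw [eq_top_iff]
  rintro x -
  obtain ⟨p, rfl⟩ := Ideal.Quotient.mk_surjective x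
  induction p using MvPolynomial.induction_on with
  | C c => exact Subalgebra.algebraMap_mem _ c
  | add p q hp hq => rw [map_add]; exact add_mem hp hq
  | mul_X p v hp =>
    rw [map_mul]
    refine mul_mem hp (Algebra.subset_adjoin ?_)
    have hlt : ∀ a : Fin (2 * r), ordIdx r a < 2 * r := fun a => by
      have := a.2
      unfold ordIdx
      split_ifs <;> lia
    exact ⟨_, hlt v.1, _, hlt v.2, (ordPairing_ordIdx (genMat r F) v.1 v.2).symm⟩

variable (r F) in
/-- The parametrization of `V` by the generic isotropic matrix. -/
def paramHom : FV r F →ₐ[F] MvPolynomial (ℕ ×ₗ ℕ) F :=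
  Ideal.Quotient.liftₐ (VIdeal r F)
    (aeval fun p : Fin (2 * r) × Fin (2 * r) => genPairing F r (ordIdx r p.1) (ordIdx r p.2))
    fun a ha => by
      refine (VIdeal_le_ker_iff (aeval fun p : Fin (2 * r) × Fin (2 * r) =>
        genPairing F r (ordIdx r p.1) (ordIdx r p.2)).toRingHom).mpr ?_ ha
      convert (sympRel_genPairing (F := F) r).memV
      ext a b : 1
      simp [Ygen]

lemma paramHom_tabProd {T : Multiset (Finset ℕ)} (hT : GoodTab r T) :
    paramHom r F (tabProd (ordPairing (genMat r F)) T) = tabProd (genPairing F r) T := by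
  rw [tabProd, map_multiset_prod, Multiset.map_map, tabProd]
  congr 1
  refine Multiset.map_congr rfl fun I hI => ?_
  have hlt : ∀ i ∈ I.sort (· ≤ ·), i < 2 * r := fun i hi =>
    Finset.mem_range.mp (hT.subset I hI ((Finset.mem_sort _).mp hi))
  rw [Function.comp_apply, pfS, pfS, ← RingHom.coe_coe, map_pfL]
  refine pfL_congr fun i hi j hj => ?_
  obtain ⟨a, rfl⟩ := exists_ordIdx (hlt i hi)
  obtain ⟨b, rfl⟩ := exists_ordIdx (hlt j hj)
  rw [ordPairing_ordIdx]
  exact aeval_X _ (a, b)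

lemma paramHom_injective (h2 : 0 < r → (2 : F) ≠ 0)
    (hF : ∀ k : ℕ, 1 ≤ k → k ≤ r → (k : F) ≠ 0) : Function.Injective (paramHom r F) := by
  have hu : 0 < r → IsUnit (2 : FV r F) := fun hr => by
    have := (h2 hr).isUnit.map (algebraMap F (FV r F))
    rwa [map_ofNat] at this
  have hspan := span_goodTab_eq_top (memV_genMat.sympRel_ordPairing hu) hF
    (adjoin_ordPairing_genMat (r := r) (F := F))
  rw [injective_iff_map_eq_zero]
  intro x hx
  have hmem : x ∈ Submodule.span F (Set.range fun T : {T // GoodTab r T} =>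
      tabProd (ordPairing (genMat r F)) T.1) := by
    have : x ∈ (⊤ : Submodule F (FV r F)) := trivial
    rw [← hspan] at this
    refine Submodule.span_mono ?_ this
    rintro _ ⟨T, rfl, hT⟩
    exact ⟨⟨T, hT⟩, rfl⟩
  obtain ⟨c, rfl⟩ := Finsupp.mem_span_range_iff_exists_finsupp.mp hmem
  have hc := linearIndependent_iff.mp (linearIndependent_tabProd_genPairing (F := F) r) c (by
    rw [← hx, Finsupp.linearCombination_apply, Finsupp.sum, Finsupp.sum, map_sum]
    refine Finset.sum_congr rfl fun T _ => ?_
    rw [map_smul, paramHom_tabProd T.2])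
  rw [hc, Finsupp.sum_zero_index]

end CoordinateRing

/-- Let `n = 2r` be divisible by 4 and `F` a field with `char F = 0` or
`char F > r`. Then the coordinate ring `F[V]` is an integral domain. -/
theorem FV_isDomain (r : ℕ) (h4 : 4 ∣ 2 * r) (F : Type*) [Field F]
    (hchar : ringChar F = 0 ∨ r < ringChar F) :
    IsDomain (FV r F) := by
  have hF : ∀ k : ℕ, 1 ≤ k → k ≤ r → (k : F) ≠ 0 := by
    intro k h1 hk h0
    have hd := (ringChar.spec F k).mp h0
    rcases hchar with h | h
    · rw [h, zero_dvd_iff] at hd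
      exact absurd hd (by lia)
    · exact absurd (Nat.le_of_dvd h1 hd) (by lia)
  have h2 : 0 < r → (2 : F) ≠ 0 := fun hr => by exact_mod_cast hF 2 one_le_two (by lia)
  exact (paramHom_injective h2 hF).isDomain (paramHom r F).toRingHom

end PR
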